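/- arXiv:1012.2681 — 2 statements merged into one kernel-verified Lean document; each statement's English description precedes it below -/
import Mathlib

section
/- For every real c with −1/2 < c < 0, the function y ↦ h(c+iy) is integrable over ℝ and (1/(2π)) ∫_{−∞}^{∞} h(c+iy) dy = 4/π², where h(s) = [(1/2)_s^5 / ((1)_s)^4] · (10s²+6s+1) · Γ(−s) · 2^{2s}. -/
open Complex MeasureTheory Real

/-- Complex rising factorial `(a)ₛ = Γ(a+s)/Γ(a)`. -/
noncomputable def cpoch (a s : ℂ) : ℂ := Complex.Gamma (a + s) / Complex.Gamma a

/-- Complex power of a positive real base: `b^s = exp(s · log b)` with the real logarithm. -/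
noncomputable def cpowR (b : ℝ) (s : ℂ) : ℂ := Complex.exp (s * (Real.log b : ℂ))

/-- The integrand `h`. -/
noncomputable def h5 (s : ℂ) : ℂ :=
  (cpoch (1/2) s ^ 5 / (cpoch 1 s)^4) * (10*s^2 + 6*s + 1) *
    Complex.Gamma (-s) * cpowR 2 (2*s)

/-! ### Analytic tools -/

lemma integrable_line_of_decay (f : ℝ → ℂ) (hf : Continuous f) (C : ℝ)
    (hC : ∀ y : ℝ, 1 ≤ |y| → ‖f y‖ ≤ C / y ^ 2) : Integrable f := by
  obtain ⟨M, hM⟩ := (isCompact_Icc (a := (-1 : ℝ)) (b := 1)).exists_bound_of_continuousOn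
    hf.continuousOn
  have hM0 : 0 ≤ M := (norm_nonneg _).trans (hM 0 (by simp))
  have hC0 : 0 ≤ C := by
    have := (norm_nonneg _).trans (hC 1 (by simp)); simpa using this
  refine Integrable.mono' (integrable_inv_one_add_sq.const_mul (2 * (M + C)))
    hf.aestronglyMeasurable (Filter.Eventually.of_forall fun y => ?_)
  rw [← div_eq_mul_inv]
  by_cases hy : 1 ≤ |y|
  · refine (hC y hy).trans ?_
    have h1 : 1 ≤ y ^ 2 := by rw [← sq_abs]; nlinarith
    rw [div_le_div_iff₀ (by linarith) (by positivity)]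
    nlinarith
  · push Not at hy
    have h2 := abs_lt.1 hy
    refine (hM y ⟨h2.1.le, h2.2.le⟩).trans ?_
    have h1 : y ^ 2 ≤ 1 := by rw [← sq_abs]; nlinarith [abs_nonneg y]
    rw [le_div_iff₀ (by positivity)]
    nlinarith

def strip : Set ℂ := {s : ℂ | -1/2 < s.re ∧ s.re < 1}

lemma strip_open : IsOpen strip :=
  (isOpen_lt continuous_const Complex.continuous_re).inter
    (isOpen_lt Complex.continuous_re continuous_const)

lemma continuous_line (f : ℂ → ℂ) (hf : DifferentiableOn ℂ f strip) (a : ℝ)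
    (ha : -1/2 < a) (ha' : a < 1) : Continuous fun y : ℝ => f ((a : ℂ) + (y : ℂ) * I) := by
  rw [← continuousOn_univ]
  refine hf.continuousOn.comp (by fun_prop) ?_
  intro y _
  simp [strip, ha, ha']

lemma vertical_shift (f : ℂ → ℂ) (hf : DifferentiableOn ℂ f strip) (a b C : ℝ)
    (ha : -1/2 < a) (hab : a ≤ b) (hb : b < 1)
    (hC : ∀ s : ℂ, a ≤ s.re → s.re ≤ b → 1 ≤ |s.im| → ‖f s‖ ≤ C / s.im ^ 2) :
    ∫ y : ℝ, f ((a : ℂ) + (y : ℂ) * I) = ∫ y : ℝ, f ((b : ℂ) + (y : ℂ) * I) := by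
  have ia : Integrable fun y : ℝ => f ((a : ℂ) + (y : ℂ) * I) :=
    integrable_line_of_decay _ (continuous_line f hf a ha (by linarith)) C
      (fun y hy => by simpa using hC (a + y * I) (by simp) (by simpa using hab) (by simpa using hy))
  have ib : Integrable fun y : ℝ => f ((b : ℂ) + (y : ℂ) * I) :=
    integrable_line_of_decay _ (continuous_line f hf b (by linarith) hb) C
      (fun y hy => by simpa using hC (b + y * I) (by simpa using hab) (by simp) (by simpa using hy))
  have ta := intervalIntegral_tendsto_integral ia Filter.tendsto_neg_atTop_atBot Filter.tendsto_id
  have tb := intervalIntegral_tendsto_integral ib Filter.tendsto_neg_atTop_atBot Filter.tendsto_id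
  have key : Filter.Tendsto (fun T : ℝ => (∫ y in (-T)..T, f ((b : ℂ) + (y : ℂ) * I)) -
      ∫ y in (-T)..T, f ((a : ℂ) + (y : ℂ) * I)) Filter.atTop (nhds 0) := by
    have hlim : Filter.Tendsto (fun T : ℝ => 2 * (C / T ^ 2 * |b - a|)) Filter.atTop (nhds 0) := by
      have : Filter.Tendsto (fun T : ℝ => C / T ^ 2) Filter.atTop (nhds 0) :=
        Filter.Tendsto.div_atTop tendsto_const_nhds (Filter.tendsto_pow_atTop (by norm_num))
      simpa using (this.mul_const |b - a|).const_mul 2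
    refine squeeze_zero_norm' ?_ hlim
    filter_upwards [Filter.eventually_ge_atTop (1 : ℝ)] with T hT
    have h0 := Complex.integral_boundary_rect_eq_zero_of_differentiableOn f
      ((a : ℂ) + ((-T : ℝ) : ℂ) * I) ((b : ℂ) + (T : ℂ) * I) (hf.mono (by
        rintro s ⟨hs, _⟩
        simp [Set.uIcc_of_le hab] at hs
        exact ⟨by linarith [hs.1], by linarith [hs.2]⟩))
    simp only [add_re, ofReal_re, mul_re, I_re, mul_zero, ofReal_im, I_im, mul_one, sub_self,
      add_zero, add_im, mul_im, zero_add] at h0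
    have b1 : ‖∫ x in a..b, f ((x : ℂ) + ((-T : ℝ) : ℂ) * I)‖ ≤ C / T ^ 2 * |b - a| := by
      refine intervalIntegral.norm_integral_le_of_norm_le_const fun x hx => ?_
      rw [Set.uIoc_of_le hab] at hx
      have := hC ((x : ℂ) + ((-T : ℝ) : ℂ) * I) (by simpa using hx.1.le) (by simpa using hx.2)
        (by simp; exact hT.trans (le_abs_self T))
      simpa using this
    have b2 : ‖∫ x in a..b, f ((x : ℂ) + (T : ℂ) * I)‖ ≤ C / T ^ 2 * |b - a| := by
      refine intervalIntegral.norm_integral_le_of_norm_le_const fun x hx => ?_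
      rw [Set.uIoc_of_le hab] at hx
      have := hC ((x : ℂ) + (T : ℂ) * I) (by simpa using hx.1.le) (by simpa using hx.2)
        (by simp; exact hT.trans (le_abs_self T))
      simpa using this
    have e : I * ((∫ y in (-T)..T, f ((b : ℂ) + (y : ℂ) * I)) -
        ∫ y in (-T)..T, f ((a : ℂ) + (y : ℂ) * I)) =
        (∫ x in a..b, f ((x : ℂ) + (T : ℂ) * I)) -
          ∫ x in a..b, f ((x : ℂ) + ((-T : ℝ) : ℂ) * I) := by
      simp only [smul_eq_mul] at h0
      linear_combination h0
    have e2 := congrArg norm e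
    rw [norm_mul, Complex.norm_I, one_mul] at e2
    rw [e2]
    refine (norm_sub_le _ _).trans ?_
    linarith
  have := tendsto_nhds_unique key (tb.sub ta)
  exact (sub_eq_zero.1 this.symm).symm

/-- The function `Γ(1/2+z)/Γ(1+z)`. -/
noncomputable def rr (z : ℂ) : ℂ := Complex.Gamma (1/2 + z) / Complex.Gamma (1 + z)

lemma rr_bound (σ : ℝ) (hσ : -1/2 < σ) (z : ℂ) (hz : σ ≤ z.re) :
    ‖rr z‖ ≤ Real.Gamma (1/2 + σ) / Real.Gamma (1 + σ) := by
  have beta : ∀ w : ℂ, -1/2 < w.re → Complex.betaIntegral (1/2 + w) (1/2) =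
      rr w * (Real.Gamma (1/2) : ℂ) := by
    intro w hw
    have h := Complex.Gamma_mul_Gamma_eq_betaIntegral (s := 1/2 + w) (t := 1/2)
      (by simp; linarith) (by simp)
    have e : (1/2 + w + 1/2 : ℂ) = 1 + w := by ring
    rw [e] at h
    have hne : Complex.Gamma (1 + w) ≠ 0 := Complex.Gamma_ne_zero_of_re_pos (by simp; linarith)
    have h2 : (Real.Gamma (1/2) : ℂ) = Complex.Gamma (1/2) := by
      rw [← Complex.Gamma_ofReal]; norm_num
    rw [h2, rr, div_mul_eq_mul_div, h, mul_div_cancel_left₀ _ hne]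
  have hσ' := beta σ (by simpa using hσ)
  have hzz := beta z (by linarith)
  have hg : (0:ℝ) < Real.Gamma (1/2) := Real.Gamma_pos_of_pos (by norm_num)
  have hreal : Complex.betaIntegral (1/2 + (σ : ℂ)) (1/2) =
      ((∫ x in (0:ℝ)..1, x ^ (σ - 1/2) * (1 - x) ^ (-1/2 : ℝ) : ℝ) : ℂ) := by
    rw [Complex.betaIntegral, ← intervalIntegral.integral_ofReal]
    refine intervalIntegral.integral_congr fun x hx => ?_
    rw [Set.uIcc_of_le zero_le_one] at hx
    rw [Complex.ofReal_mul, Complex.ofReal_cpow hx.1, Complex.ofReal_cpow (by linarith [hx.2])]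
    push_cast
    congr 2 <;> ring
  have hinteg : IntervalIntegrable (fun x : ℝ => x ^ (σ - 1/2) * (1 - x) ^ (-1/2 : ℝ)) volume 0 1 := by
    have h := (Complex.betaIntegral_convergent (u := 1/2 + (σ : ℂ)) (v := 1/2)
      (by simp; linarith) (by simp)).norm
    refine h.congr ?_
    intro x hx
    rw [Set.uIoc_of_le zero_le_one] at hx
    simp only
    rw [norm_mul, Complex.norm_cpow_eq_rpow_re_of_pos hx.1]
    have : (1 - (x:ℂ)) = ((1 - x : ℝ) : ℂ) := by push_cast; ring
    rw [this, Complex.norm_cpow_eq_rpow_re_of_nonneg (by linarith [hx.2]) (by norm_num)]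
    congr 2
    · simp; ring
    · norm_num
  have hle : ‖Complex.betaIntegral (1/2 + z) (1/2)‖ ≤
      ∫ x in (0:ℝ)..1, x ^ (σ - 1/2) * (1 - x) ^ (-1/2 : ℝ) := by
    rw [Complex.betaIntegral]
    refine intervalIntegral.norm_integral_le_of_norm_le zero_le_one
      (Filter.Eventually.of_forall fun x hx => ?_) hinteg
    rw [norm_mul, Complex.norm_cpow_eq_rpow_re_of_pos hx.1]
    have : (1 - (x:ℂ)) = ((1 - x : ℝ) : ℂ) := by push_cast; ring
    rw [this, Complex.norm_cpow_eq_rpow_re_of_nonneg (by linarith [hx.2]) (by norm_num)]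
    refine mul_le_mul ?_ (le_of_eq ?_) (Real.rpow_nonneg (by linarith [hx.2]) _)
      (Real.rpow_nonneg hx.1.le _)
    · refine Real.rpow_le_rpow_of_exponent_ge hx.1 hx.2 ?_
      simp; linarith
    · norm_num
  have hrσ : rr σ = ((Real.Gamma (1/2 + σ) / Real.Gamma (1 + σ) : ℝ) : ℂ) := by
    rw [rr]; push_cast [← Complex.Gamma_ofReal]; norm_num
  rw [hreal, hrσ] at hσ'
  have e3 : (∫ x in (0:ℝ)..1, x ^ (σ - 1/2) * (1 - x) ^ (-1/2 : ℝ)) =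
      Real.Gamma (1/2 + σ) / Real.Gamma (1 + σ) * Real.Gamma (1/2) := by exact_mod_cast hσ'
  rw [hzz, e3, norm_mul, Complex.norm_real, Real.norm_of_nonneg hg.le] at hle
  exact le_of_mul_le_mul_right hle hg

lemma sin_lower (s : ℂ) (hs : 1 ≤ |s.im|) :
    |s.im| ^ 7 / 20160 ≤ ‖Complex.sin (π * s)‖ := by
  have h1 : Complex.sin (π * s) =
      (Complex.exp (-(π * s) * I) - Complex.exp (π * s * I)) * I / 2 := rfl
  set y := s.im with hy
  have hpi := Real.pi_gt_three
  have n1 : ‖Complex.exp (-(π * s) * I)‖ = Real.exp (π * y) := by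
    rw [Complex.norm_exp]; simp [hy]
  have n2 : ‖Complex.exp (π * s * I)‖ = Real.exp (-(π * y)) := by
    rw [Complex.norm_exp]; simp [hy]
  have h2 : |Real.exp (π * y) - Real.exp (-(π * y))| / 2 ≤ ‖Complex.sin (π * s)‖ := by
    rw [h1, norm_div, norm_mul, Complex.norm_I, mul_one]
    have := abs_norm_sub_norm_le (Complex.exp (-(π * s) * I)) (Complex.exp (π * s * I))
    rw [n1, n2] at this
    simp only [Complex.norm_ofNat]
    linarith
  have h3 : Real.exp |y| - 1 ≤ |Real.exp (π * y) - Real.exp (-(π * y))| := by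
    rcases le_total 0 y with h | h
    · rw [abs_of_nonneg h] at hs ⊢
      refine le_trans ?_ (le_abs_self _)
      have := Real.exp_le_exp.2 (show y ≤ π * y by nlinarith)
      have := Real.exp_le_one_iff.2 (show -(π * y) ≤ 0 by nlinarith)
      linarith
    · rw [abs_of_nonpos h] at hs ⊢
      refine le_trans ?_ (neg_le_abs _)
      have := Real.exp_le_exp.2 (show -y ≤ -(π * y) by nlinarith)
      have := Real.exp_le_one_iff.2 (show π * y ≤ 0 by nlinarith)
      linarith
  have h4 : 1 ≤ Real.exp |y| / 2 := by
    have := Real.add_one_le_exp |y|; linarith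
  have h5 := Real.pow_div_factorial_le_exp |y| (abs_nonneg _) 7
  have : ((Nat.factorial 7 : ℕ) : ℝ) = 5040 := by norm_num [Nat.factorial]
  rw [this] at h5
  have : |y| ^ 7 / 20160 = |y| ^ 7 / 5040 / 4 := by ring
  linarith

/-! ### The WZ family -/

noncomputable def MM (s : ℂ) : ℂ :=
  rr s * Complex.Gamma (1/2 + s) * Complex.Gamma (1 - s) * cpowR 2 (2*s)

noncomputable def DD (k : ℕ) (s : ℂ) : ℂ :=
  ∏ j ∈ Finset.range k, (2*(j:ℂ)+1)^2 / ((1 + 2*j + s) * (2 + 2*j + s))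

noncomputable def HH (k : ℕ) (s : ℂ) : ℂ := MM s * rr (k + s) ^ 3 * DD k s

noncomputable def pp (k : ℕ) (s : ℂ) : ℂ := 10*s^2 + 6*s + 1 + 14*s*k + 4*k^2 + 4*k

noncomputable def LL (k : ℕ) (s : ℂ) : ℂ :=
  2*(2*k+1)^2 + 5*s*(2*k+1) + 2*s^2 - (2*k+1) - s

noncomputable def gg (k : ℕ) (s : ℂ) : ℂ := HH k s * pp k s

noncomputable def FF (k : ℕ) (s : ℂ) : ℂ := HH k s * LL k s / (1 + 2*k + s)

lemma ne_of_re {z : ℂ} (h : 0 < z.re) : z ≠ 0 := by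
  rintro rfl; simp at h

lemma Gamma_diff {z : ℂ} (h : 0 < z.re) : DifferentiableAt ℂ Complex.Gamma z := by
  refine Complex.differentiableAt_Gamma z fun m hm => ?_
  rw [hm] at h; simp at h
  have : (0:ℝ) ≤ m := Nat.cast_nonneg m
  linarith

lemma rr_diff {z : ℂ} (h : -1/2 < z.re) : DifferentiableAt ℂ rr z := by
  unfold rr
  refine DifferentiableAt.div ?_ ?_ (Complex.Gamma_ne_zero_of_re_pos (by simp; linarith))
  · exact (Gamma_diff (by simp; linarith)).comp z (f := fun z => 1/2 + z) (by fun_prop)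
  · exact (Gamma_diff (by simp; linarith)).comp z (f := fun z => 1 + z) (by fun_prop)

lemma MM_diff {z : ℂ} (h : z ∈ strip) : DifferentiableAt ℂ MM z := by
  obtain ⟨h1, h2⟩ := h
  unfold MM
  refine DifferentiableAt.mul (DifferentiableAt.mul (DifferentiableAt.mul (rr_diff h1) ?_) ?_) ?_
  · exact (Gamma_diff (by simp; linarith)).comp z (f := fun z => 1/2 + z) (by fun_prop)
  · exact (Gamma_diff (by simp; linarith)).comp z (f := fun z => 1 - z) (by fun_prop)
  · unfold cpowR; fun_prop

lemma lin_pos {z : ℂ} (h : -1/2 < z.re) (j : ℕ) (t : ℝ) (ht : 1/2 ≤ t) :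
    (t : ℂ) + j + z ≠ 0 := by
  have : (0:ℝ) ≤ j := Nat.cast_nonneg j
  refine ne_of_re ?_
  simp; linarith

lemma ne1 {z : ℂ} (h : -1/2 < z.re) (j : ℕ) : 1 + 2 * (j:ℂ) + z ≠ 0 := by
  have := lin_pos h (2*j) 1 (by norm_num); push_cast at this; exact this

lemma ne2 {z : ℂ} (h : -1/2 < z.re) (j : ℕ) : 2 + 2 * (j:ℂ) + z ≠ 0 := by
  have := lin_pos h (2*j) 2 (by norm_num); push_cast at this; exact this

lemma DD_diff (k : ℕ) {z : ℂ} (h : -1/2 < z.re) : DifferentiableAt ℂ (DD k) z := by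
  unfold DD
  refine DifferentiableAt.fun_finsetProd fun j _ => ?_
  exact DifferentiableAt.div (by fun_prop) (by fun_prop) (mul_ne_zero (ne1 h j) (ne2 h j))

lemma HH_diff (k : ℕ) {z : ℂ} (h : z ∈ strip) : DifferentiableAt ℂ (HH k) z := by
  unfold HH
  refine DifferentiableAt.mul (DifferentiableAt.mul (MM_diff h) ?_) (DD_diff k h.1)
  refine DifferentiableAt.pow ?_ 3
  have : (0:ℝ) ≤ k := Nat.cast_nonneg k
  exact (rr_diff (by simp; linarith [h.1])).comp z (f := fun z : ℂ => (k:ℂ) + z) (by fun_prop)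

lemma gg_diff (k : ℕ) {z : ℂ} (h : z ∈ strip) : DifferentiableAt ℂ (gg k) z := by
  unfold gg
  exact DifferentiableAt.mul (HH_diff k h) (by unfold pp; fun_prop)

lemma FF_diff (k : ℕ) {z : ℂ} (h : z ∈ strip) : DifferentiableAt ℂ (FF k) z := by
  unfold FF
  exact DifferentiableAt.div (DifferentiableAt.mul (HH_diff k h) (by unfold LL; fun_prop))
    (by fun_prop) (ne1 h.1 k)

lemma norm_s_le (s : ℂ) (h1 : -1/2 < s.re) (h2 : s.re < 1) (hs : 1 ≤ |s.im|) :
    ‖s‖ ≤ 2 * |s.im| := by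
  have := Complex.norm_le_abs_re_add_abs_im s
  have : |s.re| ≤ 1 := abs_le.2 ⟨by linarith, by linarith⟩
  linarith

lemma MM_bound (a : ℝ) (ha : -1/2 < a) : ∃ C : ℝ, 0 ≤ C ∧ ∀ s : ℂ, a ≤ s.re → s.re < 1 →
    1 ≤ |s.im| → ‖MM s‖ ≤ C / |s.im| ^ 6 := by
  set R := Real.Gamma (1/2 + a) / Real.Gamma (1 + a) with hR
  have hR0 : 0 ≤ R := div_nonneg (Real.Gamma_pos_of_pos (by linarith)).le
    (Real.Gamma_pos_of_pos (by linarith)).le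
  refine ⟨R ^ 2 * 2 * π * 20160 * Real.exp (2 * Real.log 2), by positivity, fun s h1 h2 hs => ?_⟩
  have hy : 0 < |s.im| := by linarith
  have hs0 : s ≠ 0 := by rintro rfl; simp at hy
  have hG : Complex.Gamma (1 + s) ≠ 0 := Complex.Gamma_ne_zero_of_re_pos (by simp; linarith)
  have e : MM s = rr s ^ 2 * s * (π / Complex.sin (π * s)) * cpowR 2 (2*s) := by
    rw [← Complex.Gamma_mul_Gamma_one_sub]
    have : Complex.Gamma (1/2 + s) = rr s * (s * Complex.Gamma s) := by
      rw [← Complex.Gamma_add_one s hs0, add_comm s 1, rr, div_mul_cancel₀ _ hG]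
    rw [MM, this]; ring
  have hc : ‖cpowR 2 (2*s)‖ ≤ Real.exp (2 * Real.log 2) := by
    rw [cpowR, Complex.norm_exp]
    refine Real.exp_le_exp.2 ?_
    have hl : 0 < Real.log 2 := Real.log_pos (by norm_num)
    rw [Complex.re_mul_ofReal]; simp; nlinarith
  have hsin := sin_lower s hs
  have hsin' : π / ‖Complex.sin (π * s)‖ ≤ π / (|s.im| ^ 7 / 20160) :=
    div_le_div_of_nonneg_left Real.pi_pos.le (by positivity) hsin
  have hr := rr_bound a ha s h1
  rw [e, norm_mul, norm_mul, norm_mul, norm_pow, norm_div, Complex.norm_real,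
    Real.norm_of_nonneg Real.pi_pos.le]
  calc _ ≤ R ^ 2 * (2 * |s.im|) * (π / (|s.im| ^ 7 / 20160)) * Real.exp (2 * Real.log 2) := by
        gcongr
        exact norm_s_le s (by linarith) h2 hs
    _ = _ := by field_simp

lemma norm_lin_ge (s : ℂ) (t u : ℝ) (j : ℕ) (_hu : 0 ≤ t + u * j + s.re) :
    t + u * j + s.re ≤ ‖(t : ℂ) + u * j + s‖ := by
  have := Complex.re_le_norm ((t : ℂ) + u * j + s)
  simpa using this

lemma DD_bound (k : ℕ) (s : ℂ) (hs : -1/2 < s.re) :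
    ‖DD k s‖ ≤ ∏ j ∈ Finset.range k, (2*(j:ℝ)+1)^2 * 4 := by
  unfold DD
  rw [norm_prod]
  refine Finset.prod_le_prod (fun _ _ => norm_nonneg _) fun j _ => ?_
  have hj : (0:ℝ) ≤ j := Nat.cast_nonneg j
  have h1 := norm_lin_ge s 1 2 j (by linarith)
  have h2 := norm_lin_ge s 2 2 j (by linarith)
  push_cast at h1 h2
  have e : ‖2*(j:ℂ)+1‖ = 2*(j:ℝ)+1 := by
    have : (2*(j:ℂ)+1) = ((2*(j:ℝ)+1 : ℝ) : ℂ) := by push_cast; ring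
    rw [this, Complex.norm_real, Real.norm_of_nonneg (by linarith)]
  rw [norm_div, norm_mul, norm_pow, e, div_le_iff₀ (by
    apply mul_pos <;> linarith)]
  have : 1/4 ≤ ‖1 + 2 * (j:ℂ) + s‖ * ‖2 + 2 * (j:ℂ) + s‖ := by
    have h3 : 1/2 ≤ ‖1 + 2 * (j:ℂ) + s‖ := by linarith
    have h4 : 1/2 ≤ ‖2 + 2 * (j:ℂ) + s‖ := by linarith
    nlinarith
  nlinarith [sq_nonneg (2*(j:ℝ)+1)]

lemma HH_bound (k : ℕ) (a : ℝ) (ha : -1/2 < a) : ∃ C : ℝ, 0 ≤ C ∧ ∀ s : ℂ, a ≤ s.re → s.re < 1 →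
    1 ≤ |s.im| → ‖HH k s‖ ≤ C / |s.im| ^ 6 := by
  obtain ⟨C, hC0, hC⟩ := MM_bound a ha
  set R := Real.Gamma (1/2 + a) / Real.Gamma (1 + a) with hR
  have hR0 : 0 ≤ R := div_nonneg (Real.Gamma_pos_of_pos (by linarith)).le
    (Real.Gamma_pos_of_pos (by linarith)).le
  have hP : 0 ≤ ∏ j ∈ Finset.range k, (2*(j:ℝ)+1)^2 * 4 := Finset.prod_nonneg fun _ _ => by positivity
  refine ⟨C * R ^ 3 * ∏ j ∈ Finset.range k, (2*(j:ℝ)+1)^2 * 4, by positivity, fun s h1 h2 hs => ?_⟩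
  have hk : (0:ℝ) ≤ k := Nat.cast_nonneg k
  have hr := rr_bound a ha (k + s) (by simp; linarith)
  rw [HH, norm_mul, norm_mul, norm_pow]
  calc _ ≤ C / |s.im| ^ 6 * R ^ 3 * ∏ j ∈ Finset.range k, (2*(j:ℝ)+1)^2 * 4 := by
        gcongr
        · exact hC s h1 h2 hs
        · exact DD_bound k s (by linarith)
    _ = _ := by ring

lemma pp_bound (k : ℕ) (s : ℂ) : ‖pp k s‖ ≤ 14 * ((k:ℝ)+1)^2 * (1 + ‖s‖)^2 := by
  have hk : (0:ℝ) ≤ k := Nat.cast_nonneg k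
  have h0 := norm_nonneg s
  have : ‖pp k s‖ ≤ 10*‖s‖^2 + 6*‖s‖ + 1 + 14*‖s‖*k + 4*(k:ℝ)^2 + 4*k := by
    unfold pp
    refine (norm_add_le _ _).trans (add_le_add ((norm_add_le _ _).trans (add_le_add
      ((norm_add_le _ _).trans (add_le_add ((norm_add_le _ _).trans (add_le_add
      ((norm_add_le _ _).trans (add_le_add ?_ ?_)) ?_)) ?_)) ?_)) ?_) <;> simp
  refine this.trans ?_
  have := mul_nonneg hk h0
  nlinarith [mul_nonneg this hk, mul_nonneg this h0, mul_nonneg (mul_nonneg this hk) h0, sq_nonneg (k:ℝ), sq_nonneg ‖s‖]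

lemma LL_bound (k : ℕ) (s : ℂ) : ‖LL k s‖ ≤ 11 * (2*(k:ℝ)+1)^2 * (1 + ‖s‖)^2 := by
  have hk : (0:ℝ) ≤ k := Nat.cast_nonneg k
  have h0 := norm_nonneg s
  have e : (2*(k:ℂ)+1) = ((2*(k:ℝ)+1 : ℝ) : ℂ) := by push_cast; ring
  have hq : (1:ℝ) ≤ 2*k+1 := by linarith
  unfold LL
  rw [e]
  generalize (2*(k:ℝ)+1) = q at *
  have : ‖2*(q:ℂ)^2 + 5*s*q + 2*s^2 - q - s‖ ≤ 2*q^2 + 5*‖s‖*q + 2*‖s‖^2 + q + ‖s‖ := by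
    have hqn : ‖(q:ℂ)‖ = q := by rw [Complex.norm_real, Real.norm_of_nonneg (by linarith)]
    refine (norm_sub_le _ _).trans (add_le_add ((norm_sub_le _ _).trans (add_le_add
      ((norm_add_le _ _).trans (add_le_add ((norm_add_le _ _).trans (add_le_add ?_ ?_)) ?_)) ?_))
       ?_) <;> simp [abs_of_pos (show 0 < q by linarith)]
  refine this.trans ?_
  have h1 : q ≤ q^2 := by nlinarith
  nlinarith [mul_nonneg h0 (show 0 ≤ q^2 - q by linarith), mul_nonneg (sq_nonneg ‖s‖) (show 0 ≤ q^2 - 1 by nlinarith), mul_nonneg h0 (show 0 ≤ q^2 - 1 by nlinarith)]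

lemma gg_bound (k : ℕ) (a : ℝ) (ha : -1/2 < a) : ∃ C : ℝ, 0 ≤ C ∧ ∀ s : ℂ, a ≤ s.re → s.re < 1 →
    1 ≤ |s.im| → ‖gg k s‖ ≤ C / s.im ^ 2 := by
  obtain ⟨C, hC0, hC⟩ := HH_bound k a ha
  refine ⟨C * (14 * ((k:ℝ)+1)^2 * 9), by positivity, fun s h1 h2 hs => ?_⟩
  rw [gg, norm_mul, ← sq_abs s.im]
  have hn := norm_s_le s (by linarith) h2 hs
  calc _ ≤ C / |s.im| ^ 6 * (14 * ((k:ℝ)+1)^2 * (3 * |s.im|)^2) := by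
        gcongr
        · exact hC s h1 h2 hs
        · refine (pp_bound k s).trans ?_
          gcongr; linarith
    _ = C * (14 * ((k:ℝ)+1)^2 * 9) / |s.im| ^ 4 := by field_simp; ring
    _ ≤ _ := by
        exact div_le_div_of_nonneg_left (by positivity) (by positivity)
          (pow_le_pow_right₀ hs (by norm_num))

lemma FF_bound (k : ℕ) (a : ℝ) (ha : -1/2 < a) : ∃ C : ℝ, 0 ≤ C ∧ ∀ s : ℂ, a ≤ s.re → s.re < 1 →
    1 ≤ |s.im| → ‖FF k s‖ ≤ C / s.im ^ 2 := by
  obtain ⟨C, hC0, hC⟩ := HH_bound k a ha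
  refine ⟨C * (11 * (2*(k:ℝ)+1)^2 * 9) * 2, by positivity, fun s h1 h2 hs => ?_⟩
  have hk : (0:ℝ) ≤ k := Nat.cast_nonneg k
  have hden := norm_lin_ge s 1 2 k (by linarith)
  push_cast at hden
  have hden' : 1/2 ≤ ‖1 + 2 * (k:ℂ) + s‖ := by linarith
  rw [FF, norm_div, norm_mul, ← sq_abs s.im]
  have hn := norm_s_le s (by linarith) h2 hs
  calc _ ≤ C / |s.im| ^ 6 * (11 * (2*(k:ℝ)+1)^2 * (3 * |s.im|)^2) / (1/2) := by
        gcongr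
        · exact hC s h1 h2 hs
        · refine (LL_bound k s).trans ?_
          gcongr; linarith
    _ = C * (11 * (2*(k:ℝ)+1)^2 * 9) * 2 / |s.im| ^ 4 := by field_simp; ring
    _ ≤ _ := by
        exact div_le_div_of_nonneg_left (by positivity) (by positivity)
          (pow_le_pow_right₀ hs (by norm_num))

/-! ### The WZ relation -/

lemma rr_succ {z : ℂ} (h : -1/2 < z.re) : rr (z + 1) = rr z * ((1/2 + z) / (1 + z)) := by
  have h1 : (1/2 + z) ≠ 0 := ne_of_re (by simp; linarith)
  have h2 : (1 + z) ≠ 0 := ne_of_re (by simp; linarith)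
  have hG : Complex.Gamma (1 + z) ≠ 0 := Complex.Gamma_ne_zero_of_re_pos (by simp; linarith)
  rw [rr, rr, ← add_assoc, ← add_assoc, Complex.Gamma_add_one _ h1, Complex.Gamma_add_one _ h2]
  field_simp

lemma DD_succ (k : ℕ) (s : ℂ) : DD (k+1) s =
    DD k s * ((2*(k:ℂ)+1)^2 / ((1 + 2*k + s) * (2 + 2*k + s))) := by
  rw [DD, Finset.prod_range_succ, ← DD]

lemma DD_shift (k : ℕ) {s : ℂ} (h : -1/2 < s.re) :
    DD k (s+1) = DD k s * ((1 + s) / (1 + 2*k + s)) := by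
  induction k with
  | zero =>
    have := ne1 h 0
    simp at this
    simp [DD, this]
  | succ k ih =>
    rw [DD_succ, DD_succ, ih]
    have a1 := ne1 h k
    have a2 := ne2 h k
    have a3 := ne1 h (k+1)
    push_cast at a3 ⊢
    have e1 : 1 + 2*(k:ℂ) + (s+1) = 2 + 2*k + s := by ring
    have e2 : 2 + 2*(k:ℂ) + (s+1) = 1 + 2*(k+1) + s := by ring
    rw [e1, e2]
    field_simp

lemma MM_shift {s : ℂ} (h : -1/2 < s.re) (h0 : s ≠ 0) :
    MM (s+1) = MM s * ((1/2 + s) / (1 + s)) * (1/2 + s) * (4 / (-s)) := by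
  have h1 : (1/2 + s) ≠ 0 := ne_of_re (by simp; linarith)
  have hp : cpowR 2 (2*(s+1)) = cpowR 2 (2*s) * 4 := by
    unfold cpowR
    rw [show 2*(s+1) * (Real.log 2 : ℂ) = 2*s*(Real.log 2 : ℂ) + ((2 * Real.log 2 : ℝ) : ℂ) by
      push_cast; ring, Complex.exp_add, ← Complex.ofReal_exp]
    have : Real.exp (2 * Real.log 2) = 4 := by
      rw [two_mul, Real.exp_add, Real.exp_log (by norm_num)]; norm_num
    rw [this]; norm_num
  have hg : Complex.Gamma (1 - s) = (-s) * Complex.Gamma (1 - (s+1)) := by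
    rw [show 1 - (s+1) = -s by ring, ← Complex.Gamma_add_one _ (neg_ne_zero.2 h0)]
    congr 1; ring
  rw [MM, MM, rr_succ h, ← add_assoc, Complex.Gamma_add_one _ h1, hp, hg]
  field_simp

lemma wz (k : ℕ) {s : ℂ} (h : -1/2 < s.re) (h0 : s ≠ 0) :
    gg (k+1) s / s - gg k s / s = FF k (s+1) - FF k s := by
  have hk : (0:ℝ) ≤ k := Nat.cast_nonneg k
  have h2 : (1 + s) ≠ 0 := ne_of_re (by simp; linarith)
  have h3 : (1 + (k + s)) ≠ 0 := ne_of_re (by simp; linarith)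
  have a1 := ne1 h k
  have a2 := ne2 h k
  have e0 : rr (((k+1 : ℕ) : ℂ) + s) = rr (k + s) * ((1/2 + (k+s)) / (1 + (k+s))) := by
    rw [← rr_succ (by simp; linarith)]; congr 1; push_cast; ring
  have e1 : rr ((k : ℂ) + (s+1)) = rr (k + s) * ((1/2 + (k+s)) / (1 + (k+s))) := by
    rw [← rr_succ (by simp; linarith)]; congr 1; ring
  have e2 : 1 + 2*(k:ℂ) + (s+1) = 2 + 2*k + s := by ring
  have H1 : HH (k+1) s = HH k s * (((1/2 + (k+s)) / (1 + (k+s)))^3 *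
      ((2*(k:ℂ)+1)^2 / ((1 + 2*k + s) * (2 + 2*k + s)))) := by
    rw [HH, HH, e0, DD_succ]; ring
  have H2 : HH k (s+1) = HH k s * (((1/2 + (k+s)) / (1 + (k+s)))^3 *
      (((1/2 + s) / (1 + s)) * (1/2 + s) * (4 / (-s))) * ((1 + s) / (1 + 2*k + s))) := by
    rw [HH, HH, e1, DD_shift k h, MM_shift h h0]; ring
  rw [gg, gg, FF, FF, H1, H2, e2]
  generalize HH k s = H
  generalize hK : (k:ℂ) = K at *
  simp only [pp, LL, hK]
  push_cast
  rw [hK]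
  clear e0 e1 e2 H1 H2 hK
  obtain ⟨A, hA⟩ : ∃ A, A = 2 + 2 * K + s := ⟨_, rfl⟩
  obtain ⟨B, hB⟩ : ∃ B, B = 1 + 2 * K + s := ⟨_, rfl⟩
  obtain ⟨D, hD⟩ : ∃ D, D = 1 + (K + s) := ⟨_, rfl⟩
  rw [← hA, ← hB, ← hD]
  rw [← hA] at a2
  rw [← hB] at a1
  rw [← hD] at h3
  field_simp
  subst hA hB hD
  ring

lemma integrable_gg (k : ℕ) (a : ℝ) (ha : -1/2 < a) (ha1 : a < 1) (ha0 : a ≠ 0) :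
    Integrable (fun y : ℝ => gg k ((a : ℂ) + (y : ℂ) * I) / ((a : ℂ) + (y : ℂ) * I)) := by
  obtain ⟨C, hC0, hC⟩ := gg_bound k a ha
  have hne : ∀ y : ℝ, ((a : ℂ) + (y : ℂ) * I) ≠ 0 := fun y hy => ha0 (by
    simpa using congrArg Complex.re hy)
  refine integrable_line_of_decay _ (Continuous.div (continuous_line (gg k)
    (fun z hz => (gg_diff k hz).differentiableWithinAt) a ha ha1) (by fun_prop) hne) C
    fun y hy => ?_
  have h := hC ((a : ℂ) + (y : ℂ) * I) (by simp) (by simpa using ha1) (by simpa using hy)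
  have hn : 1 ≤ ‖(a : ℂ) + (y : ℂ) * I‖ := by
    refine le_trans ?_ (Complex.abs_im_le_norm _)
    simpa using hy
  rw [norm_div]
  refine (div_le_self (norm_nonneg _) hn).trans ?_
  simpa using h

lemma integrable_FF (k : ℕ) (a : ℝ) (ha : -1/2 < a) (ha1 : a < 1) :
    Integrable (fun y : ℝ => FF k ((a : ℂ) + (y : ℂ) * I)) := by
  obtain ⟨C, hC0, hC⟩ := FF_bound k a ha
  refine integrable_line_of_decay _ (continuous_line (FF k)
    (fun z hz => (FF_diff k hz).differentiableWithinAt) a ha ha1) C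
    fun y hy => ?_
  have h := hC ((a : ℂ) + (y : ℂ) * I) (by simp) (by simpa using ha1) (by simpa using hy)
  simpa using h

lemma step (k : ℕ) (c : ℝ) (hc1 : -1/2 < c) (hc2 : c < 0) :
    ∫ y : ℝ, gg (k+1) ((c : ℂ) + (y : ℂ) * I) / ((c : ℂ) + (y : ℂ) * I) =
    ∫ y : ℝ, gg k ((c : ℂ) + (y : ℂ) * I) / ((c : ℂ) + (y : ℂ) * I) := by
  rw [← sub_eq_zero, ← integral_sub (integrable_gg _ c hc1 (by linarith) hc2.ne)
    (integrable_gg _ c hc1 (by linarith) hc2.ne)]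
  obtain ⟨C, hC0, hC⟩ := FF_bound k c hc1
  have e : ∀ y : ℝ, gg (k+1) ((c : ℂ) + (y : ℂ) * I) / ((c : ℂ) + (y : ℂ) * I) -
      gg k ((c : ℂ) + (y : ℂ) * I) / ((c : ℂ) + (y : ℂ) * I) =
      FF k (((c+1 : ℝ) : ℂ) + (y : ℂ) * I) - FF k ((c : ℂ) + (y : ℂ) * I) := by
    intro y
    rw [wz k (by simpa using hc1) (fun hy => hc2.ne (by simpa using congrArg Complex.re hy))]
    congr 2
    push_cast; ring
  simp_rw [e]
  rw [integral_sub (integrable_FF k (c+1) (by linarith) (by linarith))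
    (integrable_FF k c hc1 (by linarith)), sub_eq_zero]
  exact (vertical_shift (FF k) (fun z hz => (FF_diff k hz).differentiableWithinAt) c (c+1) C hc1
    (by linarith) (by linarith) fun s h1 h2 h3 => hC s h1 (by linarith) h3).symm

/-! ### The residue at zero -/

lemma kernel_integrable (σ : ℝ) (h1 : -1/2 < σ) (h0 : σ ≠ 0) :
    Integrable (fun y : ℝ => 1 / (((σ : ℂ) + (y : ℂ) * I) * ((σ : ℂ) + (y : ℂ) * I + 1))) := by
  have hne : ∀ y : ℝ, ((σ : ℂ) + (y : ℂ) * I) ≠ 0 := fun y hy => h0 (by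
    simpa using congrArg Complex.re hy)
  have hne1 : ∀ y : ℝ, ((σ : ℂ) + (y : ℂ) * I + 1) ≠ 0 := fun y =>
    ne_of_re (by simp; linarith)
  refine integrable_line_of_decay _ (Continuous.div (by fun_prop) (by fun_prop)
    fun y => mul_ne_zero (hne y) (hne1 y)) 1 fun y hy => ?_
  have n1 := Complex.abs_im_le_norm ((σ : ℂ) + (y : ℂ) * I)
  have n2 := Complex.abs_im_le_norm ((σ : ℂ) + (y : ℂ) * I + 1)
  simp at n1 n2
  rw [norm_div, norm_mul, norm_one, ← sq_abs y, sq]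
  gcongr

lemma kernel_integral (σ m : ℝ) (h1 : -1/2 < σ) (h0 : σ ≠ 0)
    (hb : Filter.Tendsto (fun y : ℝ => Real.arctan (y / σ)) Filter.atTop (nhds m)) :
    ∫ y : ℝ, 1 / (((σ : ℂ) + (y : ℂ) * I) * ((σ : ℂ) + (y : ℂ) * I + 1)) =
      ((2 * m - π : ℝ) : ℂ) := by
  have hne : ∀ y : ℝ, ((σ : ℂ) + (y : ℂ) * I) ≠ 0 := fun y hy => h0 (by
    simpa using congrArg Complex.re hy)
  have hne1 : ∀ y : ℝ, ((σ : ℂ) + (y : ℂ) * I + 1) ≠ 0 := fun y =>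
    ne_of_re (by simp; linarith)
  have hA : ∀ t : ℝ, t ≠ 0 → ∀ y : ℝ, HasDerivAt (fun y : ℝ =>
      ((Real.arctan (y / t) : ℝ) : ℂ) - I / 2 * ((Real.log (t ^ 2 + y ^ 2) : ℝ) : ℂ))
      (1 / ((t : ℂ) + (y : ℂ) * I)) y := by
    intro t ht y
    have hp : 0 < t ^ 2 + y ^ 2 := by positivity
    have d1 : HasDerivAt (fun y : ℝ => Real.arctan (y / t)) (1 / (1 + (y/t)^2) * (1 / t)) y :=
      ((hasDerivAt_id y).div_const t).arctan
    have d2 : HasDerivAt (fun y : ℝ => Real.log (t ^ 2 + y ^ 2)) ((2 * y) / (t^2 + y^2)) y := by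
      have := ((hasDerivAt_pow 2 y).const_add (t^2)).log hp.ne'
      simpa using this
    have d := d1.ofReal_comp.sub (d2.ofReal_comp.const_mul (I / 2))
    refine d.congr_deriv ?_
    have ht' : (t:ℂ) ≠ 0 := by exact_mod_cast ht
    have hp' : (t:ℂ)^2 + (y:ℂ)^2 ≠ 0 := by exact_mod_cast hp.ne'
    have hz : (t:ℂ) + y * I ≠ 0 := fun hy => ht (by simpa using congrArg Complex.re hy)
    have e : 1 / (1 + (y/t)^2) * (1 / t) = t / (t^2 + y^2) := by
      have : 1 + (y/t)^2 ≠ 0 := by positivity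
      field_simp
    rw [e]
    push_cast
    rw [eq_div_iff hz]
    field_simp
    ring_nf
    simp only [Complex.I_sq]
    ring
  have hs1 : σ + 1 ≠ 0 := by linarith
  have hd : ∀ y : ℝ, HasDerivAt (fun y : ℝ =>
      (((Real.arctan (y / σ) : ℝ) : ℂ) - I / 2 * ((Real.log (σ ^ 2 + y ^ 2) : ℝ) : ℂ)) -
      (((Real.arctan (y / (σ+1)) : ℝ) : ℂ) - I / 2 * ((Real.log ((σ+1) ^ 2 + y ^ 2) : ℝ) : ℂ)))
      (1 / (((σ : ℂ) + (y : ℂ) * I) * ((σ : ℂ) + (y : ℂ) * I + 1))) y := by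
    intro y
    refine ((hA σ h0 y).sub (hA (σ+1) hs1 y)).congr_deriv ?_
    have e : (((σ + 1 : ℝ) : ℂ) + (y:ℂ) * I) = (σ : ℂ) + (y : ℂ) * I + 1 := by push_cast; ring
    rw [e]
    have := hne y
    have := hne1 y
    field_simp
    ring
  have hlog : ∀ l : Filter ℝ, Filter.Tendsto (fun y : ℝ => y ^ 2) l Filter.atTop →
      Filter.Tendsto (fun y : ℝ => Real.log (σ^2 + y^2) - Real.log ((σ+1)^2 + y^2)) l (nhds 0) := by
    intro l hl
    have t1 : Filter.Tendsto (fun y : ℝ => 1 + (σ^2 - (σ+1)^2) / ((σ+1)^2 + y^2)) l (nhds 1) := by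
      have := (Filter.Tendsto.div_atTop (tendsto_const_nhds (x := σ^2 - (σ+1)^2))
        (Filter.tendsto_atTop_add_const_left l ((σ+1)^2) hl)).const_add 1
      simpa using this
    have t2 := (Real.continuousAt_log one_ne_zero).tendsto.comp t1
    rw [Real.log_one] at t2
    refine t2.congr fun y => ?_
    have p1 : 0 < σ^2 + y^2 := by positivity
    have p2 : 0 < (σ+1)^2 + y^2 := by positivity
    rw [← Real.log_div p1.ne' p2.ne']
    simp only [Function.comp]
    congr 1
    field_simp
    ring
  have harc : Filter.Tendsto (fun y : ℝ => Real.arctan (y / (σ+1))) Filter.atTop (nhds (π/2)) :=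
    (Real.tendsto_arctan_atTop.mono_right nhdsWithin_le_nhds).comp
      (Filter.tendsto_id.atTop_div_const (by linarith))
  have comb : ∀ (l : Filter ℝ) (u v : ℝ), Filter.Tendsto (fun y : ℝ => y ^ 2) l Filter.atTop →
      Filter.Tendsto (fun y : ℝ => Real.arctan (y / σ)) l (nhds u) →
      Filter.Tendsto (fun y : ℝ => Real.arctan (y / (σ+1))) l (nhds v) →
      Filter.Tendsto (fun y : ℝ =>
      (((Real.arctan (y / σ) : ℝ) : ℂ) - I / 2 * ((Real.log (σ ^ 2 + y ^ 2) : ℝ) : ℂ)) -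
      (((Real.arctan (y / (σ+1)) : ℝ) : ℂ) - I / 2 * ((Real.log ((σ+1) ^ 2 + y ^ 2) : ℝ) : ℂ)))
      l (nhds ((u - v : ℝ) : ℂ)) := by
    intro l u v h2 hu hv
    have t1 := ((Complex.continuous_ofReal.tendsto _).comp (hu.sub hv))
    have t2 := ((Complex.continuous_ofReal.tendsto _).comp (hlog l h2)).const_mul (I / 2)
    have t3 := t1.sub t2
    simp only [Complex.ofReal_zero, mul_zero, sub_zero] at t3
    refine t3.congr fun y => ?_
    simp only [Function.comp]
    push_cast
    ring
  have sqtop : Filter.Tendsto (fun y : ℝ => y ^ 2) Filter.atTop Filter.atTop :=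
    Filter.tendsto_pow_atTop (by norm_num)
  have sqbot : Filter.Tendsto (fun y : ℝ => y ^ 2) Filter.atBot Filter.atTop := by
    have := sqtop.comp Filter.tendsto_neg_atBot_atTop
    refine this.congr fun y => ?_
    simp
  have negf : ∀ t u : ℝ, Filter.Tendsto (fun y : ℝ => Real.arctan (y / t)) Filter.atTop (nhds u) →
      Filter.Tendsto (fun y : ℝ => Real.arctan (y / t)) Filter.atBot (nhds (-u)) := by
    intro t u h
    have := (h.comp Filter.tendsto_neg_atBot_atTop).neg
    refine this.congr fun y => ?_
    simp [neg_div, Real.arctan_neg]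
  rw [integral_of_hasDerivAt_of_tendsto hd (kernel_integrable σ h1 h0)
    (comb _ _ _ sqbot (negf _ _ hb) (negf _ _ harc)) (comb _ _ _ sqtop hb harc)]
  push_cast; ring

lemma kernel_neg (σ : ℝ) (h1 : -1/2 < σ) (h0 : σ < 0) :
    ∫ y : ℝ, 1 / (((σ : ℂ) + (y : ℂ) * I) * ((σ : ℂ) + (y : ℂ) * I + 1)) = -2 * π := by
  rw [kernel_integral σ (-(π/2)) h1 h0.ne]
  · push_cast; ring
  · exact (Real.tendsto_arctan_atBot.mono_right nhdsWithin_le_nhds).comp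
      (Filter.tendsto_id.atTop_div_const_of_neg h0)

lemma kernel_half :
    ∫ y : ℝ, 1 / ((((1/2 : ℝ) : ℂ) + (y : ℂ) * I) * (((1/2 : ℝ) : ℂ) + (y : ℂ) * I + 1)) = 0 := by
  rw [kernel_integral (1/2) (π/2) (by norm_num) (by norm_num)]
  · push_cast; ring
  · exact (Real.tendsto_arctan_atTop.mono_right nhdsWithin_le_nhds).comp
      (Filter.tendsto_id.atTop_div_const (by norm_num))

lemma residue (k : ℕ) (c : ℝ) (hc1 : -1/2 < c) (hc2 : c < 0) :
    (∫ y : ℝ, gg k ((c : ℂ) + (y : ℂ) * I) / ((c : ℂ) + (y : ℂ) * I)) + 2 * π * gg k 0 =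
    ∫ y : ℝ, gg k (((1/2 : ℝ) : ℂ) + (y : ℂ) * I) / (((1/2 : ℝ) : ℂ) + (y : ℂ) * I) := by
  obtain ⟨C, hC0, hC⟩ := gg_bound k c hc1
  set u : ℂ → ℂ := fun s => gg k s - gg k 0 / (s + 1) with hu
  have hmem : (0 : ℂ) ∈ strip := by simp [strip]; norm_num
  have hud : DifferentiableOn ℂ u strip := by
    intro z hz
    refine DifferentiableAt.differentiableWithinAt ?_
    exact (gg_diff k hz).sub (DifferentiableAt.div (by fun_prop) (by fun_prop)
      (ne_of_re (by simp; linarith [hz.1])))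
  have hd := (Complex.differentiableOn_dslope (strip_open.mem_nhds hmem)).2 hud
  have hval : ∀ s : ℂ, s ≠ 0 → dslope u 0 s = gg k s / s - gg k 0 * (1 / (s * (s + 1))) := by
    intro s hs
    rw [dslope_of_ne _ hs, slope_def_field]
    simp only [hu]
    simp only [zero_add, div_one, sub_self, sub_zero]
    rw [sub_div, div_div, mul_comm (s+1) s]
    ring
  have hsh := vertical_shift (dslope u 0) hd c (1/2) (C + ‖gg k 0‖) hc1 (by linarith)
    (by norm_num) (by
      intro s h1 h2 h3
      have hs0 : s ≠ 0 := by rintro rfl; simp at h3; linarith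
      have hy : 0 < |s.im| := by linarith
      have n1 := Complex.abs_im_le_norm s
      have n2 := Complex.abs_im_le_norm (s + 1)
      simp only [add_im, one_im, add_zero] at n2
      have hg := hC s h1 (by linarith) h3
      rw [hval s hs0]
      refine (norm_sub_le _ _).trans ?_
      rw [add_div, norm_div, norm_mul, norm_div, norm_mul, norm_one]
      refine add_le_add ?_ ?_
      · exact (div_le_self (norm_nonneg _) (by linarith)).trans hg
      · rw [mul_one_div, ← sq_abs, sq]
        gcongr)
  have hne : ∀ (a y : ℝ), a ≠ 0 → ((a : ℂ) + (y : ℂ) * I) ≠ 0 := fun a y ha hy => ha (by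
    simpa using congrArg Complex.re hy)
  have ev : ∀ a : ℝ, -1/2 < a → a < 1 → a ≠ 0 →
      ∫ y : ℝ, dslope u 0 ((a : ℂ) + (y : ℂ) * I) =
      (∫ y : ℝ, gg k ((a : ℂ) + (y : ℂ) * I) / ((a : ℂ) + (y : ℂ) * I)) - gg k 0 *
      ∫ y : ℝ, 1 / (((a : ℂ) + (y : ℂ) * I) * ((a : ℂ) + (y : ℂ) * I + 1)) := by
    intro a h1 h2 h3
    rw [← integral_const_mul, ← integral_sub (integrable_gg k a h1 h2 h3)
      ((kernel_integrable a h1 h3).const_mul _)]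
    exact integral_congr_ae (Filter.Eventually.of_forall fun y => hval _ (hne a y h3))
  rw [ev c hc1 (by linarith) hc2.ne, ev (1/2) (by norm_num) (by norm_num) (by norm_num),
    kernel_neg c hc1 hc2, kernel_half] at hsh
  linear_combination hsh

/-! ### The limit `k → ∞` -/

lemma DD_half (k : ℕ) (s : ℂ) (hs : s.re = 1/2) : ‖DD k s‖ ≤ 1 / ((k:ℝ) + 1) := by
  induction k with
  | zero => simp [DD]
  | succ k ih =>
    have hk : (0:ℝ) ≤ k := Nat.cast_nonneg k
    have h1 := norm_lin_ge s 1 2 k (by rw [hs]; linarith)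
    have h2 := norm_lin_ge s 2 2 k (by rw [hs]; linarith)
    rw [hs] at h1 h2
    push_cast at h1 h2
    have e : ‖2*(k:ℂ)+1‖ = 2*(k:ℝ)+1 := by
      have : (2*(k:ℂ)+1) = ((2*(k:ℝ)+1 : ℝ) : ℂ) := by push_cast; ring
      rw [this, Complex.norm_real, Real.norm_of_nonneg (by linarith)]
    rw [DD_succ, norm_mul, norm_div, norm_mul, norm_pow, e]
    push_cast
    calc _ ≤ 1 / ((k:ℝ) + 1) * ((2*(k:ℝ)+1)^2 / ((1 + 2*k + 1/2) * (2 + 2*k + 1/2))) := by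
          gcongr
      _ ≤ _ := by
          rw [div_mul_div_comm, div_le_div_iff₀ (by positivity) (by positivity)]
          nlinarith [mul_nonneg hk hk, mul_nonneg (mul_nonneg hk hk) hk]

noncomputable def rk (k : ℕ) : ℝ := Real.Gamma (1/2 + ((k:ℝ) + 1/2)) / Real.Gamma (1 + ((k:ℝ) + 1/2))

lemma rk_pos (k : ℕ) : 0 < rk k :=
  div_pos (Real.Gamma_pos_of_pos (by positivity)) (Real.Gamma_pos_of_pos (by positivity))

lemma rk_succ (k : ℕ) : rk (k+1) = rk k * (((k:ℝ)+1) / ((k:ℝ) + 3/2)) := by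
  have h1 : (1/2 + ((k:ℝ) + 1/2)) ≠ 0 := by positivity
  have h2 : (1 + ((k:ℝ) + 1/2)) ≠ 0 := by positivity
  have e1 : 1/2 + (((k+1 : ℕ):ℝ) + 1/2) = (1/2 + ((k:ℝ) + 1/2)) + 1 := by push_cast; ring
  have e2 : 1 + (((k+1 : ℕ):ℝ) + 1/2) = (1 + ((k:ℝ) + 1/2)) + 1 := by push_cast; ring
  rw [rk, rk, e1, e2, Real.Gamma_add_one h1, Real.Gamma_add_one h2, mul_div_mul_comm]
  rw [show (1/2 + ((k:ℝ) + 1/2)) = k + 1 by ring, show (1 + ((k:ℝ) + 1/2)) = k + 3/2 by ring]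
  ring

lemma rk_sq (k : ℕ) : rk k ^ 2 * ((k:ℝ) + 1) ≤ rk 0 ^ 2 := by
  induction k with
  | zero => simp
  | succ k ih =>
    refine le_trans ?_ ih
    have hk : (0:ℝ) ≤ k := Nat.cast_nonneg k
    rw [rk_succ, mul_pow, mul_assoc]
    refine mul_le_mul_of_nonneg_left ?_ (sq_nonneg _)
    push_cast
    rw [div_pow, div_mul_eq_mul_div, div_le_iff₀ (by positivity)]
    nlinarith [mul_nonneg hk hk, mul_nonneg (mul_nonneg hk hk) hk]

lemma rk_tendsto : Filter.Tendsto rk Filter.atTop (nhds 0) := by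
  have h : Filter.Tendsto (fun k : ℕ => rk k ^ 2) Filter.atTop (nhds 0) := by
    have t : Filter.Tendsto (fun k : ℕ => rk 0 ^ 2 / ((k:ℝ) + 1)) Filter.atTop (nhds 0) :=
      Filter.Tendsto.div_atTop tendsto_const_nhds
        (Filter.tendsto_atTop_add_const_right _ _ tendsto_natCast_atTop_atTop)
    refine squeeze_zero (fun k => sq_nonneg _) (fun k => ?_) t
    rw [le_div_iff₀ (by positivity)]
    exact rk_sq k
  have := h.sqrt
  rw [Real.sqrt_zero] at this
  exact this.congr fun k => Real.sqrt_sq (rk_pos k).le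

lemma half_tendsto : Filter.Tendsto (fun k : ℕ =>
    ∫ y : ℝ, gg k (((1/2 : ℝ) : ℂ) + (y : ℂ) * I) / (((1/2 : ℝ) : ℂ) + (y : ℂ) * I))
    Filter.atTop (nhds 0) := by
  set ℓ : ℝ → ℂ := fun y => ((1/2 : ℝ) : ℂ) + (y : ℂ) * I with hℓ
  have hre : ∀ y, (ℓ y).re = 1/2 := fun y => by simp [hℓ]
  have him : ∀ y, (ℓ y).im = y := fun y => by simp [hℓ]
  obtain ⟨C, hC0, hC⟩ := MM_bound (1/2) (by norm_num)
  set Φ : ℝ → ℂ := fun y => MM (ℓ y) * (((14 * (1 + ‖ℓ y‖)^2 * 2 : ℝ)) : ℂ) with hΦ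
  have hMc : Continuous fun y : ℝ => MM (ℓ y) := continuous_line MM
    (fun z hz => (MM_diff hz).differentiableWithinAt) (1/2) (by norm_num) (by norm_num)
  have hℓc : Continuous ℓ := by fun_prop
  have hΦi : Integrable Φ := by
    refine integrable_line_of_decay Φ (hMc.mul (Complex.continuous_ofReal.comp (by fun_prop)))
      (C * (14 * 9 * 2)) fun y hy => ?_
    have hy0 : 0 < |y| := by linarith
    have hM := hC (ℓ y) (by rw [hre]) (by rw [hre]; norm_num) (by rw [him]; exact hy)
    have hn := norm_s_le (ℓ y) (by rw [hre]; norm_num) (by rw [hre]; norm_num)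
      (by rw [him]; exact hy)
    rw [him] at hM hn
    rw [hΦ]
    simp only
    rw [norm_mul, Complex.norm_real, Real.norm_of_nonneg (by positivity), ← sq_abs y]
    calc _ ≤ C / |y| ^ 6 * (14 * (3 * |y|)^2 * 2) := by
          gcongr; linarith
      _ = C * (14 * 9 * 2) / |y| ^ 4 := by field_simp; ring
      _ ≤ _ := by
        exact div_le_div_of_nonneg_left (by positivity) (by positivity)
          (pow_le_pow_right₀ hy (by norm_num))
  have hb : ∀ (k : ℕ) (y : ℝ), ‖gg k (ℓ y) / ℓ y‖ ≤ rk 0 ^ 2 * rk k * ‖Φ y‖ := by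
    intro k y
    have hk : (0:ℝ) ≤ k := Nat.cast_nonneg k
    have hr : ‖rr (k + ℓ y)‖ ≤ rk k :=
      rr_bound ((k:ℝ) + 1/2) (by linarith) (k + ℓ y) (by simp [hre])
    have hD := DD_half k (ℓ y) (hre y)
    have hn : 1/2 ≤ ‖ℓ y‖ := by
      have := Complex.re_le_norm (ℓ y); rwa [hre] at this
    have hp := pp_bound k (ℓ y)
    have hrk := (rk_pos k).le
    rw [hΦ]
    simp only
    rw [norm_div, gg, HH, norm_mul, norm_mul, norm_mul, norm_pow, norm_mul, Complex.norm_real,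
      Real.norm_of_nonneg (by positivity)]
    calc _ ≤ ‖MM (ℓ y)‖ * rk k ^ 3 * (1 / ((k:ℝ) + 1)) *
          (14 * ((k:ℝ)+1)^2 * (1 + ‖ℓ y‖)^2) / (1/2) := by gcongr
      _ = (rk k ^ 2 * ((k:ℝ) + 1)) * (rk k * (‖MM (ℓ y)‖ * (14 * (1 + ‖ℓ y‖)^2 * 2))) := by
          field_simp
      _ ≤ rk 0 ^ 2 * (rk k * (‖MM (ℓ y)‖ * (14 * (1 + ‖ℓ y‖)^2 * 2))) := by
          gcongr; exact rk_sq k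
      _ = _ := by ring
  have t : Filter.Tendsto (fun k : ℕ => rk 0 ^ 2 * rk k * ∫ y, ‖Φ y‖) Filter.atTop (nhds 0) := by
    have := (rk_tendsto.const_mul (rk 0 ^ 2)).mul_const (∫ y, ‖Φ y‖)
    simpa using this
  refine squeeze_zero_norm (fun k => ?_) t
  rw [← integral_const_mul]
  exact norm_integral_le_of_norm_le (hΦi.norm.const_mul _)
    (Filter.Eventually.of_forall fun y => hb k y)

noncomputable def ak (k : ℕ) : ℝ := ∏ j ∈ Finset.range k, (2*(j:ℝ)+1) / (2*j+2)

lemma ak_wallis (k : ℕ) : ak k ^ 2 * (2*(k:ℝ)+1) = (Real.Wallis.W k)⁻¹ := by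
  induction k with
  | zero => simp [ak, Real.Wallis.W]
  | succ k ih =>
    rw [Real.Wallis.W_succ, mul_inv, ← ih]
    have : ak (k+1) = ak k * ((2*(k:ℝ)+1) / (2*k+2)) := by
      rw [ak, Finset.prod_range_succ, ← ak]
    rw [this]
    push_cast
    field_simp
    ring

lemma DD_zero (k : ℕ) : DD k 0 = (ak k : ℂ) := by
  rw [DD, ak]
  push_cast
  refine Finset.prod_congr rfl fun j _ => ?_
  have h1 := ne1 (z := 0) (by norm_num) j
  have h2 := ne2 (z := 0) (by norm_num) j
  rw [add_zero] at h1 h2 ⊢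
  rw [add_zero, add_comm (2 * (j:ℂ)) 1, add_comm (2 * (j:ℂ)) 2, sq, mul_div_mul_left _ _ h1]

lemma rr_nat (k : ℕ) : rr k = rr 0 * (ak k : ℂ) := by
  induction k with
  | zero => simp [ak]
  | succ k ih =>
    have hk : (0:ℝ) ≤ k := Nat.cast_nonneg k
    have : ak (k+1) = ak k * ((2*(k:ℝ)+1) / (2*k+2)) := by
      rw [ak, Finset.prod_range_succ, ← ak]
    rw [Nat.cast_succ, rr_succ (by simp; linarith), ih, this]
    push_cast
    have h1 : (1 + (k:ℂ)) ≠ 0 := ne_of_re (by simp; linarith)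
    have h2 : (2 * (k:ℂ) + 2) ≠ 0 := ne_of_re (by simp; linarith)
    have : (1/2 + (k:ℂ)) / (1 + k) = (2*(k:ℂ)+1) / (2*k+2) := by
      rw [div_eq_div_iff h1 h2]; ring
    rw [this]; ring

lemma gg_zero (k : ℕ) : gg k 0 =
    Complex.Gamma (1/2) ^ 5 * ((((Real.Wallis.W k)⁻¹) ^ 2 : ℝ) : ℂ) := by
  rw [← ak_wallis, gg, HH, MM, add_zero, add_zero, rr_nat, DD_zero]
  have : rr 0 = Complex.Gamma (1/2) := by simp [rr, Complex.Gamma_one]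
  rw [this]
  simp [cpowR, pp, Complex.Gamma_one]
  ring

lemma h5_eq (s : ℂ) (h0 : s ≠ 0) :
    h5 s = (-(Complex.Gamma (1/2) ^ 5)⁻¹) * (gg 0 s / s) := by
  have hg : Complex.Gamma (1 - s) = (-s) * Complex.Gamma (-s) := by
    rw [← Complex.Gamma_add_one _ (neg_ne_zero.2 h0)]
    congr 1; ring
  have hG : Complex.Gamma (1/2) ≠ 0 := Complex.Gamma_ne_zero_of_re_pos (by norm_num)
  rw [h5, gg, HH, MM, hg]
  simp only [cpoch, DD, pp, rr, Finset.range_zero, Finset.prod_empty, Nat.cast_zero, zero_add,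
    Complex.Gamma_one]
  by_cases hz : Complex.Gamma (1 + s) = 0
  · simp [hz]
  · field_simp
    ring

theorem barnes_integral_4_over_pi_sq (c : ℝ) (hc1 : -1/2 < c) (hc2 : c < 0) :
    Integrable (fun y : ℝ => h5 ((c : ℂ) + (y : ℂ) * Complex.I)) ∧
    (1 / (2*(π : ℂ))) * ∫ y : ℝ, h5 ((c : ℂ) + (y : ℂ) * Complex.I) =
      ((4 / π^2 : ℝ) : ℂ) := by
  have hne : ∀ y : ℝ, ((c : ℂ) + (y : ℂ) * I) ≠ 0 := fun y hy => hc2.ne (by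
    simpa using congrArg Complex.re hy)
  have hfun : (fun y : ℝ => h5 ((c : ℂ) + (y : ℂ) * Complex.I)) = fun y : ℝ =>
      (-(Complex.Gamma (1/2) ^ 5)⁻¹) *
        (gg 0 ((c : ℂ) + (y : ℂ) * I) / ((c : ℂ) + (y : ℂ) * I)) :=
    funext fun y => h5_eq _ (hne y)
  have hG : Complex.Gamma (1/2) ≠ 0 := Complex.Gamma_ne_zero_of_re_pos (by norm_num)
  have hpi : (π : ℂ) ≠ 0 := by exact_mod_cast Real.pi_ne_zero
  rw [hfun]
  refine ⟨(integrable_gg 0 c hc1 (by linarith) hc2.ne).const_mul _, ?_⟩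
  rw [integral_const_mul]
  set J := ∫ y : ℝ, gg 0 ((c : ℂ) + (y : ℂ) * I) / ((c : ℂ) + (y : ℂ) * I) with hJ
  have hk : ∀ k : ℕ, ∫ y : ℝ, gg k ((c : ℂ) + (y : ℂ) * I) / ((c : ℂ) + (y : ℂ) * I) = J := by
    intro k
    induction k with
    | zero => rfl
    | succ k ih => rw [step k c hc1 hc2, ih]
  have h1 : ∀ k : ℕ, J + 2 * π * gg k 0 =
      ∫ y : ℝ, gg k (((1/2 : ℝ) : ℂ) + (y : ℂ) * I) / (((1/2 : ℝ) : ℂ) + (y : ℂ) * I) := by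
    intro k
    rw [← residue k c hc1 hc2, hk k]
  have t1 := half_tendsto.congr fun k => (h1 k).symm
  have tW : Filter.Tendsto (fun k : ℕ => (((Real.Wallis.W k)⁻¹) ^ 2 : ℝ)) Filter.atTop
      (nhds (((π/2)⁻¹) ^ 2)) :=
    (Real.Wallis.tendsto_W_nhds_pi_div_two.inv₀ (by positivity)).pow 2
  have t2 : Filter.Tendsto (fun k : ℕ => J + 2 * π * gg k 0) Filter.atTop
      (nhds (J + 2 * π * (Complex.Gamma (1/2) ^ 5 * ((((π/2)⁻¹) ^ 2 : ℝ) : ℂ)))) := by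
    simp_rw [gg_zero]
    exact ((((Complex.continuous_ofReal.tendsto _).comp tW).const_mul _).const_mul _).const_add _
  have hJv := tendsto_nhds_unique t2 t1
  have hJ' : J = -(2 * π * (Complex.Gamma (1/2) ^ 5 * ((((π/2)⁻¹) ^ 2 : ℝ) : ℂ))) := by
    linear_combination hJv
  rw [hJ']
  push_cast
  field_simp
  norm_num
end

section
/- For every real c with −1/2 < c < 0, the function y ↦ h(c+iy) is integrable over ℝ and (1/(2π)) ∫_{−∞}^{∞} h(c+iy) dy = 1/π, where h(s) = [(1/2)_s^3 / ((1)_s)^2] · (3s+1) · Γ(−s) · 2^{3s}. -/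
open Complex MeasureTheory Real

/-- The integrand `h`. -/
noncomputable def h7 (s : ℂ) : ℂ :=
  (cpoch (1/2) s ^ 3 / (cpoch 1 s)^2) * (3*s + 1) *
    Complex.Gamma (-s) * cpowR 2 (3*s)

namespace BarnesPf

lemma norm_Gamma_le {z : ℂ} (hz : 0 < z.re) : ‖Complex.Gamma z‖ ≤ Real.Gamma z.re := by
  rw [Complex.Gamma_eq_integral hz, Real.Gamma_eq_integral hz, Complex.GammaIntegral]
  refine (norm_integral_le_integral_norm _).trans (le_of_eq ?_)
  refine setIntegral_congr_fun measurableSet_Ioi fun x hx => ?_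
  have hx' : (0:ℝ) < x := hx
  simp only [norm_mul]
  rw [Complex.norm_cpow_eq_rpow_re_of_pos hx', Complex.norm_real, Real.norm_of_nonneg (Real.exp_pos _).le]
  simp

lemma norm_beta_le {u v : ℂ} (hu : 0 < u.re) (hv : 0 < v.re) :
    ‖Complex.betaIntegral u v‖ ≤ Real.Gamma u.re * Real.Gamma v.re / Real.Gamma (u.re + v.re) := by
  have key : Complex.betaIntegral (u.re : ℂ) (v.re : ℂ)
      = ((Real.Gamma u.re * Real.Gamma v.re / Real.Gamma (u.re + v.re) : ℝ) : ℂ) := by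
    rw [Complex.betaIntegral_eq_Gamma_mul_div _ _ (by simpa) (by simpa)]
    push_cast
    rw [← Complex.ofReal_add]
    simp only [Complex.Gamma_ofReal]
  have key2 : Complex.betaIntegral (u.re : ℂ) (v.re : ℂ)
      = ((∫ x in (0:ℝ)..1, x ^ (u.re - 1) * (1 - x) ^ (v.re - 1) : ℝ) : ℂ) := by
    rw [Complex.betaIntegral, ← intervalIntegral.integral_ofReal]
    refine intervalIntegral.integral_congr fun x hx => ?_
    rw [Set.uIcc_of_le zero_le_one] at hx
    push_cast
    rw [Complex.ofReal_cpow hx.1, Complex.ofReal_cpow (by linarith [hx.2])]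
    push_cast
    rfl
  rw [key2] at key
  rw [← Complex.ofReal_inj.1 key, Complex.betaIntegral]
  refine (intervalIntegral.norm_integral_le_integral_norm zero_le_one).trans (le_of_eq ?_)
  simp only [intervalIntegral.integral_of_le zero_le_one, integral_Ioc_eq_integral_Ioo]
  refine setIntegral_congr_fun measurableSet_Ioo fun x hx => ?_
  have h1 : (1 : ℂ) - x = ((1 - x : ℝ) : ℂ) := by push_cast; rfl
  simp only [norm_mul, h1]
  rw [Complex.norm_cpow_eq_rpow_re_of_pos hx.1,
    Complex.norm_cpow_eq_rpow_re_of_pos (by linarith [hx.2])]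
  simp

lemma norm_ratio_le {z : ℂ} {β : ℝ} (hz : 0 < z.re) (hβ : 0 < β) :
    ‖Complex.Gamma z / Complex.Gamma (z + β)‖ ≤ Real.Gamma z.re / Real.Gamma (z.re + β) := by
  have h := norm_beta_le hz (v := (β : ℂ)) (by simpa)
  rw [Complex.betaIntegral_eq_Gamma_mul_div _ _ hz (by simpa)] at h
  have hb : 0 < Real.Gamma β := Real.Gamma_pos_of_pos hβ
  have e : Complex.Gamma z * Complex.Gamma β / Complex.Gamma (z + β) =
    (Complex.Gamma z / Complex.Gamma (z + β)) * ((Real.Gamma β : ℝ) : ℂ) := by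
    rw [Complex.Gamma_ofReal]; ring
  rw [e, norm_mul, Complex.norm_real, Real.norm_of_nonneg hb.le] at h
  simp only [Complex.ofReal_re] at h
  have e2 : Real.Gamma z.re * Real.Gamma β / Real.Gamma (z.re + β) =
    (Real.Gamma z.re / Real.Gamma (z.re + β)) * Real.Gamma β := by ring
  rw [e2] at h
  exact le_of_mul_le_mul_right h hb

/-- polynomial bound on a vertical strip -/
def SB (f : ℂ → ℂ) (a b : ℝ) (n : ℤ) : Prop :=
  ∃ M, 0 ≤ M ∧ ∀ s : ℂ, a ≤ s.re → s.re ≤ b → ‖f s‖ ≤ M * (1 + |s.im|) ^ n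

lemma SB.mul {f g : ℂ → ℂ} {a b : ℝ} {m n : ℤ} (hf : SB f a b m) (hg : SB g a b n) :
    SB (fun s => f s * g s) a b (m + n) := by
  obtain ⟨M, hM, hf⟩ := hf
  obtain ⟨N, hN, hg⟩ := hg
  refine ⟨M * N, by positivity, fun s h1 h2 => ?_⟩
  have hpos : (1 + |s.im|) ≠ 0 := by positivity
  rw [norm_mul, zpow_add₀ hpos]
  calc ‖f s‖ * ‖g s‖ ≤ (M * (1 + |s.im|) ^ m) * (N * (1 + |s.im|) ^ n) :=
        mul_le_mul (hf s h1 h2) (hg s h1 h2) (norm_nonneg _) (by positivity)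
    _ = _ := by ring

lemma SB.congr {f g : ℂ → ℂ} {a b : ℝ} {n : ℤ} (hf : SB f a b n)
    (h : ∀ s : ℂ, a ≤ s.re → s.re ≤ b → g s = f s) : SB g a b n := by
  obtain ⟨M, hM, hf⟩ := hf
  exact ⟨M, hM, fun s h1 h2 => by rw [h s h1 h2]; exact hf s h1 h2⟩

lemma SB.sub {f g : ℂ → ℂ} {a b : ℝ} {n : ℤ} (hf : SB f a b n) (hg : SB g a b n) :
    SB (fun s => f s - g s) a b n := by
  obtain ⟨M, hM, hf⟩ := hf
  obtain ⟨N, hN, hg⟩ := hg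
  refine ⟨M + N, by positivity, fun s h1 h2 => ?_⟩
  rw [add_mul]
  exact (norm_sub_le _ _).trans (add_le_add (hf s h1 h2) (hg s h1 h2))

lemma SB_const (c : ℂ) (a b : ℝ) : SB (fun _ => c) a b 0 :=
  ⟨‖c‖, norm_nonneg _, fun s _ _ => by simp⟩

lemma SB_affine (p q : ℂ) (a b : ℝ) : SB (fun s => p * s + q) a b 1 := by
  refine ⟨‖p‖ * (|a| + |b| + 1) + ‖q‖, by positivity, fun s h1 h2 => ?_⟩
  have hs : ‖s‖ ≤ (|a| + |b| + 1) * (1 + |s.im|) := by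
    have := Complex.norm_le_abs_re_add_abs_im s
    have h3 : |s.re| ≤ |a| + |b| := by
      rw [abs_le]
      constructor
      · linarith [neg_abs_le a, abs_nonneg b]
      · linarith [le_abs_self b, abs_nonneg a]
    nlinarith [abs_nonneg a, abs_nonneg b, abs_nonneg s.im]
  rw [zpow_one]
  have h4 : ‖p * s + q‖ ≤ ‖p‖ * ‖s‖ + ‖q‖ := (norm_add_le _ _).trans (by rw [norm_mul])
  have h5 := mul_le_mul_of_nonneg_left hs (norm_nonneg p)
  nlinarith [mul_nonneg (norm_nonneg q) (abs_nonneg s.im)]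

lemma bdd_of_cont {φ : ℝ → ℝ} {p q : ℝ} (h : ContinuousOn φ (Set.Icc p q)) :
    ∃ M, 0 ≤ M ∧ ∀ x, p ≤ x → x ≤ q → φ x ≤ M := by
  obtain ⟨M, hM⟩ := (isCompact_Icc.image_of_continuousOn h).bddAbove
  exact ⟨max M 0, le_max_right _ _, fun x h1 h2 =>
    le_max_of_le_left (hM ⟨x, ⟨h1, h2⟩, rfl⟩)⟩

lemma contOn_Gamma {p q : ℝ} (hp : 0 < p) (β : ℝ) (hβ : 0 ≤ β) :
    ContinuousOn (fun x : ℝ => Real.Gamma (x + β)) (Set.Icc p q) := by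
  intro x hx
  refine ContinuousAt.continuousWithinAt ?_
  have : ContinuousAt Real.Gamma (x + β) := by
    refine (Real.differentiableAt_Gamma fun m => ?_).continuousAt
    have : (0:ℝ) ≤ m := Nat.cast_nonneg m
    linarith [hx.1]
  exact ContinuousAt.comp (f := fun x : ℝ => x + β) this (by fun_prop)

lemma SB_Gamma {g : ℂ → ℂ} {a b p q : ℝ} (hp : 0 < p)
    (hg : ∀ s : ℂ, a ≤ s.re → s.re ≤ b → p ≤ (g s).re ∧ (g s).re ≤ q) :
    SB (fun s => Complex.Gamma (g s)) a b 0 := by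
  obtain ⟨M, hM, h⟩ := bdd_of_cont (contOn_Gamma (q := q) hp 0 le_rfl)
  refine ⟨M, hM, fun s h1 h2 => ?_⟩
  obtain ⟨h3, h4⟩ := hg s h1 h2
  have := (norm_Gamma_le (lt_of_lt_of_le hp h3)).trans (by simpa using h _ h3 h4)
  simpa using this

lemma SB_ratio {g : ℂ → ℂ} {a b p q : ℝ} (hp : 0 < p) (β : ℝ) (hβ : 0 < β)
    (hg : ∀ s : ℂ, a ≤ s.re → s.re ≤ b → p ≤ (g s).re ∧ (g s).re ≤ q) :
    SB (fun s => Complex.Gamma (g s) / Complex.Gamma (g s + β)) a b 0 := by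
  obtain ⟨M, hM, h⟩ := bdd_of_cont (((contOn_Gamma (q := q) hp 0 le_rfl)).div
    (contOn_Gamma (q := q) hp β hβ.le)
    (fun x hx => (Real.Gamma_pos_of_pos (by linarith [hx.1])).ne'))
  refine ⟨M, hM, fun s h1 h2 => ?_⟩
  obtain ⟨h3, h4⟩ := hg s h1 h2
  have := (norm_ratio_le (lt_of_lt_of_le hp h3) hβ).trans (by simpa using h _ h3 h4)
  simpa using this

lemma SB_inv {g : ℂ → ℂ} {a b p : ℝ} (hp : 0 < p)
    (hg : ∀ s : ℂ, a ≤ s.re → s.re ≤ b → p ≤ |(g s).re|)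
    (him : ∀ s, |(g s).im| = |s.im|) :
    SB (fun s => (g s)⁻¹) a b (-1) := by
  refine ⟨2 / min p 1, by positivity, fun s h1 h2 => ?_⟩
  have h3 := hg s h1 h2
  have h4 := Complex.abs_re_le_norm (g s)
  have h5 := Complex.abs_im_le_norm (g s)
  rw [him] at h5
  have hm : 0 < min p 1 := by positivity
  have hm1 : min p 1 ≤ p := min_le_left _ _
  have hm2 : min p 1 ≤ 1 := min_le_right _ _
  rw [norm_inv, zpow_neg_one, ← inv_div, ← mul_inv]
  apply inv_anti₀ (by positivity)
  nlinarith [abs_nonneg s.im]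

lemma SB_Gamma4 {g : ℂ → ℂ} {a b p q : ℝ} (hp : 0 < p)
    (hg : ∀ s : ℂ, a ≤ s.re → s.re ≤ b → p ≤ (g s).re ∧ (g s).re ≤ q)
    (him : ∀ s, |(g s).im| = |s.im|) :
    SB (fun s => Complex.Gamma (g s)) a b (-4) := by
  have hi : ∀ j : ℕ, SB (fun s => (g s + j)⁻¹) a b (-1) := fun j =>
    SB_inv (g := fun s => g s + j) hp (fun s h1 h2 => by
      have := (hg s h1 h2).1
      have hj : (0:ℝ) ≤ j := Nat.cast_nonneg j
      refine le_trans ?_ (le_abs_self _)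
      simp; linarith) (fun s => by simpa using him s)
  have h0 : SB (fun s => Complex.Gamma (g s + 4)) a b 0 :=
    SB_Gamma (g := fun s => g s + 4) (p := p) (q := q + 4) hp (fun s h1 h2 => by
      have := hg s h1 h2
      simp; constructor <;> linarith)
  refine ((((h0.mul (hi 0)).mul (hi 1)).mul (hi 2)).mul (hi 3)).congr fun s h1 h2 => ?_
  have hne : ∀ j : ℕ, g s + j ≠ 0 := fun j h => by
    have := (hg s h1 h2).1
    have hj : (0:ℝ) ≤ j := Nat.cast_nonneg j
    have h' := congrArg Complex.re h
    simp at h'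
    linarith
  have n0 := hne 0
  have n1 := hne 1
  have n2 := hne 2
  have n3 := hne 3
  push_cast at n0 n1 n2 n3 ⊢
  have e : Complex.Gamma (g s + 4) =
      (g s + 3) * ((g s + 2) * ((g s + 1) * ((g s + 0) * Complex.Gamma (g s)))) := by
    have e1 := Complex.Gamma_add_one _ n0
    have e2 := Complex.Gamma_add_one _ n1
    have e3 := Complex.Gamma_add_one _ n2
    have e4 := Complex.Gamma_add_one _ n3
    rw [add_zero] at e1 ⊢
    rw [← e1, show g s + 4 = g s + 3 + 1 by ring, e4, show g s + 3 = g s + 2 + 1 by ring, e3,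
      show g s + 2 = g s + 1 + 1 by ring, e2]
  rw [e]
  field_simp

/-- `8^s` -/
noncomputable def E8 (s : ℂ) : ℂ := Complex.exp (3 * s * (Real.log 2 : ℂ))

lemma norm_E8 (s : ℂ) : ‖E8 s‖ = Real.exp (3 * s.re * Real.log 2) := by
  rw [E8, Complex.norm_exp, mul_comm, Complex.re_ofReal_mul, mul_comm]
  congr 1
  simp

lemma E8_add_one (s : ℂ) : E8 (s + 1) = 8 * E8 s := by
  have h : Complex.exp (3 * (Real.log 2 : ℂ)) = 8 := by
    have : Real.exp (3 * Real.log 2) = 8 := by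
      rw [show (3 : ℝ) * Real.log 2 = Real.log (2 ^ 3) by rw [Real.log_pow]; norm_num,
        Real.exp_log (by norm_num)]
      norm_num
    exact_mod_cast congrArg (fun x : ℝ => (x : ℂ)) this
  rw [E8, E8, show 3 * (s + 1) * (Real.log 2 : ℂ) = 3 * (Real.log 2 : ℂ) + 3 * s * (Real.log 2 : ℂ) by ring,
    Complex.exp_add, h]

lemma SB_E8 (a b : ℝ) : SB E8 a b 0 := by
  refine ⟨Real.exp (3 * b * Real.log 2), (Real.exp_pos _).le, fun s _ h2 => ?_⟩
  rw [norm_E8]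
  have : 0 ≤ Real.log 2 := Real.log_nonneg (by norm_num)
  simp only [zpow_zero, mul_one]
  gcongr

lemma integrable_of_SB {f : ℂ → ℂ} {a b c : ℝ} (h1 : a ≤ c) (h2 : c ≤ b)
    (hc : Continuous fun y : ℝ => f ((c : ℂ) + (y : ℂ) * Complex.I)) (hb : SB f a b (-2)) :
    Integrable fun y : ℝ => f ((c : ℂ) + (y : ℂ) * Complex.I) := by
  obtain ⟨M, hM, hb⟩ := hb
  refine (integrable_inv_one_add_sq.const_mul M).mono' hc.aestronglyMeasurable
    (Filter.Eventually.of_forall fun y => ?_)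
  have := hb ((c : ℂ) + (y : ℂ) * Complex.I) (by simpa) (by simpa)
  refine this.trans ?_
  gcongr
  simp only [Complex.add_im, Complex.ofReal_im, Complex.mul_im, Complex.ofReal_re, Complex.I_im,
    Complex.I_re, mul_one, mul_zero, add_zero, zero_add]
  rw [zpow_neg]
  apply inv_anti₀ (by positivity)
  have : (1 + |y|) ^ (2:ℤ) = (1 + |y|) ^ 2 := by norm_cast
  rw [this]
  nlinarith [abs_nonneg y, sq_abs y]

lemma line_cont {f : ℂ → ℂ} {a b c : ℝ} (h1 : a ≤ c) (h2 : c ≤ b)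
    (hd : ContinuousOn f {s | a ≤ s.re ∧ s.re ≤ b}) :
    Continuous fun y : ℝ => f ((c : ℂ) + (y : ℂ) * Complex.I) := by
  refine hd.comp_continuous (by fun_prop) fun y => ?_
  simp [h1, h2]

lemma shift {f : ℂ → ℂ} {a b M : ℝ} (hab : a ≤ b)
    (hd : DifferentiableOn ℂ f {s | a ≤ s.re ∧ s.re ≤ b})
    (hb : ∀ s : ℂ, a ≤ s.re → s.re ≤ b → 1 ≤ |s.im| → ‖f s‖ ≤ M / |s.im|)
    (ia : Integrable fun y : ℝ => f ((a : ℂ) + (y : ℂ) * Complex.I))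
    (ib : Integrable fun y : ℝ => f ((b : ℂ) + (y : ℂ) * Complex.I)) :
    ∫ y : ℝ, f ((a : ℂ) + (y : ℂ) * Complex.I) = ∫ y : ℝ, f ((b : ℂ) + (y : ℂ) * Complex.I) := by
  have ta := intervalIntegral_tendsto_integral ia Filter.tendsto_neg_atTop_atBot Filter.tendsto_id
  have tb := intervalIntegral_tendsto_integral ib Filter.tendsto_neg_atTop_atBot Filter.tendsto_id
  have hdiff := tb.sub ta
  have hz : Filter.Tendsto (fun T : ℝ => (∫ y in (-T)..(id T), f ((b : ℂ) + (y : ℂ) * Complex.I)) -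
      ∫ y in (-T)..(id T), f ((a : ℂ) + (y : ℂ) * Complex.I)) Filter.atTop (nhds 0) := by
    have hlim : Filter.Tendsto (fun T : ℝ => 2 * M * |b - a| * T⁻¹) Filter.atTop (nhds 0) := by
      simpa using tendsto_inv_atTop_zero.const_mul (2 * M * |b - a|)
    refine squeeze_zero_norm' ?_ hlim
    filter_upwards [Filter.eventually_ge_atTop 1] with T hT
    have hR := Complex.integral_boundary_rect_eq_zero_of_differentiableOn f
      ((a : ℂ) + ((-T : ℝ) : ℂ) * Complex.I) ((b : ℂ) + (T : ℂ) * Complex.I) (hd.mono ?_)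
    · simp only [Complex.add_re, Complex.ofReal_re, Complex.mul_re, Complex.I_re, mul_zero,
        Complex.ofReal_im, Complex.I_im, mul_one, sub_self, add_zero, Complex.add_im,
        Complex.mul_im, zero_add, smul_eq_mul] at hR
      have hbd : ∀ τ : ℝ, |τ| = T → ‖∫ x in a..b, f ((x : ℂ) + (τ : ℂ) * Complex.I)‖
          ≤ M / T * |b - a| := by
        intro τ hτ
        refine intervalIntegral.norm_integral_le_of_norm_le_const fun x hx => ?_
        rw [Set.uIoc_of_le hab] at hx
        have := hb ((x : ℂ) + (τ : ℂ) * Complex.I) (by simpa using hx.1.le) (by simpa using hx.2)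
          (by simp [hτ, hT])
        simpa [hτ] using this
      have h1 := hbd (-T) (by rw [abs_neg, abs_of_nonneg (by linarith)])
      have h2 := hbd T (by rw [abs_of_nonneg (by linarith)])
      have e : Complex.I * ((∫ y in (-T)..(id T), f ((b : ℂ) + (y : ℂ) * Complex.I)) -
          ∫ y in (-T)..(id T), f ((a : ℂ) + (y : ℂ) * Complex.I)) =
          (∫ x in a..b, f ((x : ℂ) + (T : ℂ) * Complex.I)) -
          ∫ x in a..b, f ((x : ℂ) + ((-T : ℝ) : ℂ) * Complex.I) := by
        simp only [id]
        linear_combination hR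
      have e2 := congrArg norm e
      rw [norm_mul, Complex.norm_I, one_mul] at e2
      rw [e2]
      refine (norm_sub_le _ _).trans ((add_le_add h2 h1).trans (le_of_eq ?_))
      ring
    · intro s hs
      have := hs.1
      simp only [Complex.add_re, Complex.ofReal_re, Complex.mul_re, Complex.I_re, mul_zero,
        Complex.ofReal_im, Complex.I_im, mul_one, sub_self, add_zero, Set.mem_preimage] at this
      rw [Set.uIcc_of_le hab] at this
      exact this
  have := tendsto_nhds_unique hdiff hz
  exact (sub_eq_zero.1 this).symm

lemma shift_SB {f : ℂ → ℂ} {a b : ℝ} (hab : a ≤ b)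
    (hd : DifferentiableOn ℂ f {s | a ≤ s.re ∧ s.re ≤ b}) (hb : SB f a b (-2)) :
    ∫ y : ℝ, f ((a : ℂ) + (y : ℂ) * Complex.I) = ∫ y : ℝ, f ((b : ℂ) + (y : ℂ) * Complex.I) := by
  have ia := integrable_of_SB le_rfl hab (line_cont le_rfl hab hd.continuousOn) hb
  have ib := integrable_of_SB hab le_rfl (line_cont hab le_rfl hd.continuousOn) hb
  obtain ⟨M, hM, hb⟩ := hb
  refine shift (M := M) hab hd (fun s h1 h2 h3 => (hb s h1 h2).trans ?_) ia ib
  rw [div_eq_mul_inv, zpow_neg]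
  gcongr
  have : (1 + |s.im|) ^ (2:ℤ) = (1 + |s.im|) ^ 2 := by norm_cast
  rw [this]
  nlinarith

lemma integral_pois {p : ℝ} (hp : 0 < p) :
    (Integrable fun y : ℝ => p / (p ^ 2 + y ^ 2)) ∧ ∫ y : ℝ, p / (p ^ 2 + y ^ 2) = π := by
  have e : (fun y : ℝ => p / (p ^ 2 + y ^ 2)) = fun y => p⁻¹ * (1 + (y / p) ^ 2)⁻¹ := by
    funext y
    field_simp
  rw [e]
  constructor
  · exact (integrable_inv_one_add_sq.comp_div hp.ne').const_mul _
  · rw [integral_const_mul, Measure.integral_comp_div (fun y : ℝ => (1 + y ^ 2)⁻¹) p,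
      integral_univ_inv_one_add_sq, abs_of_pos hp, smul_eq_mul]
    field_simp

/-- auxiliary function with simple pole at `-1/2` -/
noncomputable def gg (s : ℂ) : ℂ := (s + 1/2)⁻¹ - (s + 5/2)⁻¹

lemma gg_eq {s : ℂ} (h1 : s + 1/2 ≠ 0) (h2 : s + 5/2 ≠ 0) :
    gg s = 2 * ((s + 1/2)⁻¹ * (s + 5/2)⁻¹) := by
  rw [gg, inv_sub_inv h1 h2, ← mul_inv, div_eq_mul_inv]; ring

lemma gg_line (p : ℝ) (hp : p + 1/2 ≠ 0) (hp2 : 0 < p + 5/2) :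
    Integrable fun y : ℝ => gg ((p : ℂ) + (y : ℂ) * Complex.I) := by
  have hz : ∀ q : ℝ, p + q ≠ 0 → ∀ y : ℝ, ((p : ℂ) + (y : ℂ) * Complex.I) + q ≠ 0 := by
    intro q hq y h
    have := congrArg Complex.re h
    simp at this
    exact hq this
  have hz' : ∀ s : ℂ, ∀ q : ℝ, p ≤ s.re → s.re ≤ p → p + q ≠ 0 → s + q ≠ 0 := by
    intro s q h1 h2 hq h
    have := congrArg Complex.re h
    simp at this
    exact hq (by rw [le_antisymm h1 h2]; exact this)
  have n1 := hz (1/2) hp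
  have n2 := hz (5/2) hp2.ne'
  push_cast at n1 n2
  refine integrable_of_SB (a := p) (b := p) le_rfl le_rfl ?_ ?_
  · unfold gg
    refine Continuous.sub (Continuous.inv₀ (by fun_prop) n1) (Continuous.inv₀ (by fun_prop) n2)
  · have i1 : SB (fun s => (s + 1/2)⁻¹) p p (-1) := SB_inv (p := |p + 1/2|) (by positivity)
      (fun s h1 h2 => by rw [le_antisymm h1 h2]; simp) (fun s => by simp)
    have i2 : SB (fun s => (s + 5/2)⁻¹) p p (-1) := SB_inv (p := |p + 5/2|) (by positivity)
      (fun s h1 h2 => by rw [le_antisymm h1 h2]; simp) (fun s => by simp)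
    refine ((SB_const 2 p p).mul (i1.mul i2)).congr fun s h1 h2 => ?_
    have m1 := hz' s (1/2) h1 h2 hp
    have m2 := hz' s (5/2) h1 h2 hp2.ne'
    push_cast at m1 m2
    exact gg_eq m1 m2

lemma inv_sum (p y : ℝ) (hp : p ≠ 0) :
    ((p : ℂ) + (y : ℂ) * Complex.I)⁻¹ + ((p : ℂ) + ((-y : ℝ) : ℂ) * Complex.I)⁻¹
      = ((2 * (p / (p ^ 2 + y ^ 2)) : ℝ) : ℂ) := by
  have h0 : ((p : ℂ) ^ 2 + (y : ℂ) ^ 2) ≠ 0 := by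
    have : p ^ 2 + y ^ 2 ≠ 0 := by positivity
    exact_mod_cast this
  have h : ∀ y : ℝ, (p : ℂ) + (y : ℂ) * Complex.I ≠ 0 := fun y h => by
    have := congrArg Complex.re h
    simp at this
    exact hp this
  have h1 := h y
  have h2 := h (-y)
  push_cast at h2 ⊢
  rw [inv_add_inv h1 h2, mul_div_assoc', div_eq_div_iff (mul_ne_zero h1 h2) h0]
  linear_combination (2 * (p:ℂ) * y^2) * Complex.I_sq

lemma gg_int (p : ℝ) (hp : p + 1/2 ≠ 0) (hp2 : 0 < p + 5/2) :
    ∫ y : ℝ, gg ((p : ℂ) + (y : ℂ) * Complex.I) =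
      (((∫ y : ℝ, (p + 1/2) / ((p + 1/2) ^ 2 + y ^ 2)) - π : ℝ) : ℂ) := by
  have hi := gg_line p hp hp2
  have hn : ∫ y : ℝ, gg ((p : ℂ) + ((-y : ℝ) : ℂ) * Complex.I) =
      ∫ y : ℝ, gg ((p : ℂ) + (y : ℂ) * Complex.I) :=
    integral_neg_eq_self (fun y : ℝ => gg ((p : ℂ) + (y : ℂ) * Complex.I)) volume
  have hi' : Integrable fun y : ℝ => gg ((p : ℂ) + ((-y : ℝ) : ℂ) * Complex.I) := hi.comp_neg
  have hs := integral_add hi hi'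
  rw [hn] at hs
  have hpi := integral_pois hp2
  have hpi1 : Integrable fun y : ℝ => (p + 1/2) / ((p + 1/2) ^ 2 + y ^ 2) := by
    rcases lt_or_gt_of_ne hp with h | h
    · have := (integral_pois (p := -(p + 1/2)) (by linarith)).1.neg
      refine this.congr (Filter.Eventually.of_forall fun y => ?_)
      simp only [Pi.neg_apply, neg_sq, neg_div, neg_neg]
    · exact (integral_pois h).1
  have e : ∀ y : ℝ, gg ((p : ℂ) + (y : ℂ) * Complex.I) + gg ((p : ℂ) + ((-y : ℝ) : ℂ) * Complex.I)
      = ((2 * ((p + 1/2) / ((p + 1/2) ^ 2 + y ^ 2) - (p + 5/2) / ((p + 5/2) ^ 2 + y ^ 2)) : ℝ) : ℂ) := by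
    intro y
    have a1 := inv_sum (p + 1/2) y hp
    have a2 := inv_sum (p + 5/2) y hp2.ne'
    rw [mul_sub, Complex.ofReal_sub, ← a1, ← a2, gg, gg]
    push_cast
    ring_nf
  simp only [e] at hs
  rw [integral_complex_ofReal, integral_const_mul, integral_sub hpi1 hpi.1, hpi.2] at hs
  have h2 : (2 : ℂ) ≠ 0 := two_ne_zero
  apply mul_left_cancel₀ h2
  rw [two_mul, ← hs]
  push_cast
  ring

lemma gg_right (p : ℝ) (hp : 0 < p + 1/2) :
    ∫ y : ℝ, gg ((p : ℂ) + (y : ℂ) * Complex.I) = 0 := by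
  rw [gg_int p hp.ne' (by linarith), (integral_pois hp).2]
  simp

lemma gg_left : ∫ y : ℝ, gg (((-1 : ℝ) : ℂ) + (y : ℂ) * Complex.I) = -2 * π := by
  rw [gg_int (-1) (by norm_num) (by norm_num)]
  have e : (∫ y : ℝ, ((-1 : ℝ) + 1/2) / (((-1 : ℝ) + 1/2) ^ 2 + y ^ 2)) = -π := by
    rw [← (integral_pois (p := 1/2) (by norm_num)).2, ← integral_neg]
    congr 1
    funext y
    rw [← neg_div]
    norm_num
  rw [e]
  push_cast
  ring

lemma SB.mono {f : ℂ → ℂ} {a b : ℝ} {m n : ℤ} (hf : SB f a b m) (h : m ≤ n) : SB f a b n := by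
  obtain ⟨M, hM, hf⟩ := hf
  refine ⟨M, hM, fun s h1 h2 => (hf s h1 h2).trans ?_⟩
  gcongr
  linarith [abs_nonneg s.im]

noncomputable def FF (k : ℕ) (s : ℂ) : ℂ :=
  4 ^ k * (Complex.Gamma (s + 1/2) / Complex.Gamma (s + 1)) *
    (Complex.Gamma (s + k + 1/2) / Complex.Gamma (s + 2 * k + 1)) * Complex.Gamma (s + k + 1/2) *
    (3 * s + (2 * k + 1)) * Complex.Gamma (-s) * E8 s

noncomputable def GG (k : ℕ) (s : ℂ) : ℂ :=
  4 ^ k * s * (Complex.Gamma (s + 1/2) / Complex.Gamma (s + 1)) *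
    (Complex.Gamma (s + k + 1/2) / Complex.Gamma (s + 2 * k + 2)) * Complex.Gamma (s + k + 1/2) *
    Complex.Gamma (1 - s) * E8 s

noncomputable def NN (k : ℕ) (s : ℂ) : ℂ :=
  4 ^ k * (Complex.Gamma (s + 3/2) / Complex.Gamma (s + 2)) * (s + 1) *
    (Complex.Gamma (s + k + 1/2) / Complex.Gamma (s + 2 * k + 1)) * Complex.Gamma (s + k + 1/2) *
    (3 * s + (2 * k + 1)) * Complex.Gamma (-s) * E8 s

lemma wz (k : ℕ) {s : ℂ} (h1 : -1/2 < s.re) (h2 : s.re < 0) :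
    FF (k + 1) s - FF k s = GG k (s + 1) - GG k s := by
  have hk : (0:ℝ) ≤ k := Nat.cast_nonneg k
  have ne : ∀ z : ℂ, z.re ≠ 0 → z ≠ 0 := fun z hz h => hz (by rw [h]; simp)
  have n1 : s + 1/2 ≠ 0 := ne _ (by simp; linarith)
  have n2 : s + 1 ≠ 0 := ne _ (by simp; linarith)
  have n3 : s + k + 1/2 ≠ 0 := ne _ (by simp; linarith)
  have n4 : s + 2 * k + 1 ≠ 0 := ne _ (by simp; linarith)
  have n5 : s + 2 * k + 2 ≠ 0 := ne _ (by simp; linarith)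
  have n6 : -s ≠ 0 := ne _ (by simp; linarith)
  have g2 : Complex.Gamma (s + 1) ≠ 0 := Complex.Gamma_ne_zero_of_re_pos (by simp; linarith)
  have g4 : Complex.Gamma (s + 2 * k + 1) ≠ 0 :=
    Complex.Gamma_ne_zero_of_re_pos (by simp; linarith)
  have e1 : Complex.Gamma (s + 1 + 1/2) = (s + 1/2) * Complex.Gamma (s + 1/2) := by
    rw [← Complex.Gamma_add_one _ n1]; ring_nf
  have e2 := Complex.Gamma_add_one _ n2
  have e3 : Complex.Gamma (s + 1 + k + 1/2) = (s + k + 1/2) * Complex.Gamma (s + k + 1/2) := by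
    rw [← Complex.Gamma_add_one _ n3]; ring_nf
  have e3' : Complex.Gamma (s + (k + 1) + 1/2) = (s + k + 1/2) * Complex.Gamma (s + k + 1/2) := by
    rw [← Complex.Gamma_add_one _ n3]; ring_nf
  have e4 : Complex.Gamma (s + 2 * k + 2) = (s + 2 * k + 1) * Complex.Gamma (s + 2 * k + 1) := by
    rw [← Complex.Gamma_add_one _ n4]; ring_nf
  have e5 : Complex.Gamma (s + 1 + 2 * k + 2) = (s + 2 * k + 2) * Complex.Gamma (s + 2 * k + 2) := by
    rw [← Complex.Gamma_add_one _ n5]; ring_nf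
  have e5' : Complex.Gamma (s + 2 * (k + 1) + 1) =
      (s + 2 * k + 2) * Complex.Gamma (s + 2 * k + 2) := by
    rw [← Complex.Gamma_add_one _ n5]; ring_nf
  have e6 : Complex.Gamma (1 - s) = -s * Complex.Gamma (-s) := by
    rw [← Complex.Gamma_add_one _ n6]; ring_nf
  have e7 : (1 : ℂ) - (s + 1) = -s := by ring
  unfold FF GG
  push_cast
  rw [e1, e2, e3, e3', e5, e5', e4, e6, e7, E8_add_one]
  generalize Complex.Gamma (s + 1/2) = A at *
  generalize Complex.Gamma (s + 1) = C at *
  generalize Complex.Gamma (s + k + 1/2) = B at *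
  generalize Complex.Gamma (s + 2 * k + 1) = H at *
  generalize Complex.Gamma (-s) = D at *
  generalize E8 s = E at *
  have hP := mul_inv_cancel₀ n4
  have hQ := mul_inv_cancel₀ n5
  have hS := mul_inv_cancel₀ n2
  simp only [div_eq_mul_inv, mul_inv, pow_succ] at *
  generalize (s + 2 * (k:ℂ) + 1)⁻¹ = Pi at *
  generalize (s + 2 * (k:ℂ) + 2)⁻¹ = Qi at *
  generalize (s + 1)⁻¹ = Si at *
  generalize C⁻¹ = Ci at *
  generalize H⁻¹ = Hi at *
  linear_combination (4 ^ k * A * Ci * Hi * B * B * D * E)*(3*s+2*k+1)*((s+2*k+2)*Qi)*hP + ((4 ^ k * A * Ci * Hi * B * B * D * E)*(3*s+2*k+1) + (4 ^ k * A * Ci * Hi * B * B * D * E)*s^2*Pi)*hQ - 8*(4 ^ k * A * Ci * Hi * B * B * D * E)*(s+1/2)*(s+k+1/2)^2*Pi*Qi*hS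

lemma FF_eq_NN (k : ℕ) {s : ℂ} (h1 : s + 1/2 ≠ 0) (h2 : s + 1 ≠ 0) :
    FF k s = NN k s * (s + 1/2)⁻¹ := by
  have e1 : Complex.Gamma (s + 3/2) = (s + 1/2) * Complex.Gamma (s + 1/2) := by
    rw [← Complex.Gamma_add_one _ h1]; ring_nf
  have e2 : Complex.Gamma (s + 2) = (s + 1) * Complex.Gamma (s + 1) := by
    rw [← Complex.Gamma_add_one _ h2]; ring_nf
  have e : Complex.Gamma (s + 3/2) / Complex.Gamma (s + 2) * (s + 1) * (s + 1/2)⁻¹ =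
      Complex.Gamma (s + 1/2) / Complex.Gamma (s + 1) := by
    rw [e1, e2, mul_div_mul_comm]
    have q1 := mul_inv_cancel₀ h1
    have q2 := mul_inv_cancel₀ h2
    calc _ = Complex.Gamma (s + 1/2) / Complex.Gamma (s + 1) * ((s + 1/2) * (s + 1/2)⁻¹) *
        ((s + 1) * (s + 1)⁻¹) := by ring
      _ = _ := by rw [q1, q2]; ring
  unfold FF NN
  rw [← e]
  ring

lemma SB_NN (k : ℕ) {a b : ℝ} (ha : -3/2 < a) (hb : b < 0) (hk : 0 < a + k + 1/2) :
    SB (NN k) a b (-2) := by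
  have r1 : SB (fun s => Complex.Gamma (s + 3/2) / Complex.Gamma (s + 2)) a b 0 :=
    (SB_ratio (g := fun s => s + 3/2) (p := a + 3/2) (q := b + 3/2) (by linarith) (1/2)
      (by norm_num) (fun s h1 h2 => by simp; constructor <;> linarith)).congr
      (fun s _ _ => by push_cast; ring_nf)
  have r2 : SB (fun s => Complex.Gamma (s + k + 1/2) / Complex.Gamma (s + 2 * k + 1)) a b 0 :=
    (SB_ratio (g := fun s => s + k + 1/2) (p := a + k + 1/2) (q := b + k + 1/2) hk (k + 1/2)
      (by positivity) (fun s h1 h2 => by simp; constructor <;> linarith)).congr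
      (fun s _ _ => by push_cast; ring_nf)
  have r3 : SB (fun s => Complex.Gamma (s + k + 1/2)) a b 0 :=
    SB_Gamma (g := fun s => s + k + 1/2) (p := a + k + 1/2) (q := b + k + 1/2) hk
      (fun s h1 h2 => by simp; constructor <;> linarith)
  have r4 : SB (fun s => Complex.Gamma (-s)) a b (-4) :=
    SB_Gamma4 (g := fun s => -s) (p := -b) (q := -a) (by linarith)
      (fun s h1 h2 => by simp; constructor <;> linarith) (fun s => by simp)
  have := (((((((SB_const (4 ^ k) a b).mul r1).mul (SB_affine 1 1 a b)).mul r2).mul r3).mul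
    (SB_affine 3 (2 * k + 1) a b)).mul r4).mul (SB_E8 a b)
  refine (this.congr fun s _ _ => ?_)
  unfold NN
  ring

lemma SB_FF (k : ℕ) {a b : ℝ} (ha : -1/2 < a) (hb : b < 0) : SB (FF k) a b (-3) := by
  have hk : (0:ℝ) ≤ k := Nat.cast_nonneg k
  have i : SB (fun s => (s + 1/2)⁻¹) a b (-1) := SB_inv (p := a + 1/2) (by linarith)
      (fun s h1 h2 => by refine le_trans ?_ (le_abs_self _); simp; linarith) (fun s => by simp)
  refine ((SB_NN k (by linarith) hb (by linarith)).mul i).congr fun s h1 h2 => ?_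
  have ne : ∀ z : ℂ, z.re ≠ 0 → z ≠ 0 := fun z hz h => hz (by rw [h]; simp)
  exact FF_eq_NN k (ne _ (by simp; linarith)) (ne _ (by simp; linarith))

lemma SB_GG (k : ℕ) {a b : ℝ} (ha : -1/2 < a) (hb : b < 1) : SB (GG k) a b (-2) := by
  have hk : (0:ℝ) ≤ k := Nat.cast_nonneg k
  have r1 : SB (fun s => Complex.Gamma (s + 1/2) / Complex.Gamma (s + 1)) a b 0 :=
    (SB_ratio (g := fun s => s + 1/2) (p := a + 1/2) (q := b + 1/2) (by linarith) (1/2)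
      (by norm_num) (fun s h1 h2 => by simp; constructor <;> linarith)).congr
      (fun s _ _ => by push_cast; ring_nf)
  have r2 : SB (fun s => Complex.Gamma (s + k + 1/2) / Complex.Gamma (s + 2 * k + 2)) a b 0 :=
    (SB_ratio (g := fun s => s + k + 1/2) (p := a + k + 1/2) (q := b + k + 1/2) (by linarith)
      (k + 3/2)
      (by positivity) (fun s h1 h2 => by simp; constructor <;> linarith)).congr
      (fun s _ _ => by push_cast; ring_nf)
  have r3 : SB (fun s => Complex.Gamma (s + k + 1/2)) a b 0 :=
    SB_Gamma (g := fun s => s + k + 1/2) (p := a + k + 1/2) (q := b + k + 1/2) (by linarith)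
      (fun s h1 h2 => by simp; constructor <;> linarith)
  have r4 : SB (fun s => Complex.Gamma (1 - s)) a b (-4) :=
    SB_Gamma4 (g := fun s => 1 - s) (p := 1 - b) (q := 1 - a) (by linarith)
      (fun s h1 h2 => by simp; constructor <;> linarith) (fun s => by simp)
  have := ((((((SB_const (4 ^ k) a b).mul (SB_affine 1 0 a b)).mul r1).mul r2).mul r3).mul r4).mul
    (SB_E8 a b)
  refine (this.congr fun s _ _ => ?_).mono (by norm_num : _ ≤ _)
  unfold GG
  ring

lemma dGamma {g : ℂ → ℂ} {s : ℂ} (hg : DifferentiableAt ℂ g s) (h : 0 < (g s).re) :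
    DifferentiableAt ℂ (fun s => Complex.Gamma (g s)) s := by
  have : DifferentiableAt ℂ Complex.Gamma (g s) := by
    refine Complex.differentiableAt_Gamma _ fun m hm => ?_
    rw [hm] at h
    simp at h
    linarith [(Nat.cast_nonneg m : (0:ℝ) ≤ m)]
  exact DifferentiableAt.comp s this hg

lemma dRatio {g j : ℂ → ℂ} {s : ℂ} (hg : DifferentiableAt ℂ g s) (h : 0 < (g s).re)
    (hj : DifferentiableAt ℂ j s) (h' : 0 < (j s).re) :
    DifferentiableAt ℂ (fun s => Complex.Gamma (g s) / Complex.Gamma (j s)) s :=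
  (dGamma hg h).div (dGamma hj h') (Complex.Gamma_ne_zero_of_re_pos h')

lemma dE8 (s : ℂ) : DifferentiableAt ℂ E8 s := by
  unfold E8
  fun_prop

lemma dNN (k : ℕ) {s : ℂ} (h1 : -3/2 < s.re) (h2 : s.re < 0) (hk : 0 < s.re + k + 1/2) :
    DifferentiableAt ℂ (NN k) s := by
  have hk0 : (0:ℝ) ≤ k := Nat.cast_nonneg k
  have a1 : DifferentiableAt ℂ
      (fun s : ℂ => Complex.Gamma (s + 3/2) / Complex.Gamma (s + 2)) s :=
    dRatio (by fun_prop) (by simp; linarith) (by fun_prop) (by simp; linarith)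
  have a2 : DifferentiableAt ℂ
      (fun s : ℂ => Complex.Gamma (s + k + 1/2) / Complex.Gamma (s + 2 * k + 1)) s :=
    dRatio (by fun_prop) (by simp; linarith) (by fun_prop) (by simp; linarith)
  have a3 : DifferentiableAt ℂ (fun s : ℂ => Complex.Gamma (s + k + 1/2)) s :=
    dGamma (by fun_prop) (by simp; linarith)
  have a4 : DifferentiableAt ℂ (fun s : ℂ => Complex.Gamma (-s)) s :=
    dGamma (by fun_prop) (by simp; linarith)
  have a5 := dE8 s
  have a6 : DifferentiableAt ℂ (fun s : ℂ => s + 1) s := by fun_prop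
  have a7 : DifferentiableAt ℂ (fun s : ℂ => 3 * s + (2 * (k : ℂ) + 1)) s := by fun_prop
  exact ((((((a1.const_mul (4 ^ k)).mul a6).mul a2).mul a3).mul a7).mul a4).mul a5

lemma dGG (k : ℕ) {s : ℂ} (h1 : -1/2 < s.re) (h2 : s.re < 1) :
    DifferentiableAt ℂ (GG k) s := by
  have hk0 : (0:ℝ) ≤ k := Nat.cast_nonneg k
  have a1 : DifferentiableAt ℂ
      (fun s : ℂ => Complex.Gamma (s + 1/2) / Complex.Gamma (s + 1)) s :=
    dRatio (by fun_prop) (by simp; linarith) (by fun_prop) (by simp; linarith)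
  have a2 : DifferentiableAt ℂ
      (fun s : ℂ => Complex.Gamma (s + k + 1/2) / Complex.Gamma (s + 2 * k + 2)) s :=
    dRatio (by fun_prop) (by simp; linarith) (by fun_prop) (by simp; linarith)
  have a3 : DifferentiableAt ℂ (fun s : ℂ => Complex.Gamma (s + k + 1/2)) s :=
    dGamma (by fun_prop) (by simp; linarith)
  have a4 : DifferentiableAt ℂ (fun s : ℂ => Complex.Gamma (1 - s)) s :=
    dGamma (by fun_prop) (by simp; linarith)
  have a5 := dE8 s
  have a6 : DifferentiableAt ℂ (fun s : ℂ => 4 ^ k * s) s := by fun_prop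
  exact ((((a6.mul a1).mul a2).mul a3).mul a4).mul a5

lemma dFF (k : ℕ) {s : ℂ} (h1 : -1/2 < s.re) (h2 : s.re < 0) :
    DifferentiableAt ℂ (FF k) s := by
  have hk0 : (0:ℝ) ≤ k := Nat.cast_nonneg k
  have a1 : DifferentiableAt ℂ
      (fun s : ℂ => Complex.Gamma (s + 1/2) / Complex.Gamma (s + 1)) s :=
    dRatio (by fun_prop) (by simp; linarith) (by fun_prop) (by simp; linarith)
  have a2 : DifferentiableAt ℂ
      (fun s : ℂ => Complex.Gamma (s + k + 1/2) / Complex.Gamma (s + 2 * k + 1)) s :=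
    dRatio (by fun_prop) (by simp; linarith) (by fun_prop) (by simp; linarith)
  have a3 : DifferentiableAt ℂ (fun s : ℂ => Complex.Gamma (s + k + 1/2)) s :=
    dGamma (by fun_prop) (by simp; linarith)
  have a4 : DifferentiableAt ℂ (fun s : ℂ => Complex.Gamma (-s)) s :=
    dGamma (by fun_prop) (by simp; linarith)
  have a5 := dE8 s
  have a7 : DifferentiableAt ℂ (fun s : ℂ => 3 * s + (2 * (k : ℂ) + 1)) s := by fun_prop
  exact (((((a1.const_mul (4 ^ k)).mul a2).mul a3).mul a7).mul a4).mul a5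

lemma FF_int (k : ℕ) {c : ℝ} (hc1 : -1/2 < c) (hc2 : c < 0) :
    Integrable fun y : ℝ => FF k ((c : ℂ) + (y : ℂ) * Complex.I) := by
  refine integrable_of_SB (a := c) (b := c) le_rfl le_rfl (line_cont (a := c) (b := c) le_rfl le_rfl
    fun s hs => ?_) ((SB_FF k hc1 hc2).mono (by norm_num))
  exact (dFF k (by linarith [hs.1]) (by linarith [hs.2])).continuousAt.continuousWithinAt

lemma FF_step (k : ℕ) {c : ℝ} (hc1 : -1/2 < c) (hc2 : c < 0) :
    ∫ y : ℝ, FF (k + 1) ((c : ℂ) + (y : ℂ) * Complex.I) =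
      ∫ y : ℝ, FF k ((c : ℂ) + (y : ℂ) * Complex.I) := by
  have hd : DifferentiableOn ℂ (GG k) {s | c ≤ s.re ∧ s.re ≤ c + 1} := fun s hs =>
    (dGG k (by linarith [hs.1]) (by linarith [hs.2])).differentiableWithinAt
  have hB := SB_GG k hc1 (b := c + 1) (by linarith)
  have hs := shift_SB (by linarith) hd hB
  have i1 := integrable_of_SB le_rfl (by linarith) (line_cont le_rfl (by linarith) hd.continuousOn) hB
  have i2 := integrable_of_SB (by linarith) le_rfl (line_cont (by linarith) le_rfl hd.continuousOn) hB
  rw [← sub_eq_zero, ← integral_sub (FF_int _ hc1 hc2) (FF_int _ hc1 hc2)]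
  have e : ∀ y : ℝ, FF (k + 1) ((c : ℂ) + (y : ℂ) * Complex.I) - FF k ((c : ℂ) + (y : ℂ) * Complex.I)
      = GG k (((c + 1 : ℝ) : ℂ) + (y : ℂ) * Complex.I) - GG k ((c : ℂ) + (y : ℂ) * Complex.I) := by
    intro y
    rw [wz k (by simpa using hc1) (by simpa using hc2)]
    congr 2
    push_cast
    ring
  simp only [e]
  rw [integral_sub i2 i1, hs, sub_self]

lemma FF_const (k : ℕ) {c : ℝ} (hc1 : -1/2 < c) (hc2 : c < 0) :
    ∫ y : ℝ, FF k ((c : ℂ) + (y : ℂ) * Complex.I) =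
      ∫ y : ℝ, FF 0 ((c : ℂ) + (y : ℂ) * Complex.I) := by
  induction k with
  | zero => rfl
  | succ k ih => rw [FF_step k hc1 hc2, ih]

lemma resid (k : ℕ) (hk : 1 ≤ k) {c : ℝ} (hc1 : -1/2 < c) (hc2 : c < 0) :
    ∫ y : ℝ, FF k ((c : ℂ) + (y : ℂ) * Complex.I) =
      (∫ y : ℝ, NN k (((-1 : ℝ) : ℂ) + (y : ℂ) * Complex.I) *
        ((((-1 : ℝ) : ℂ) + (y : ℂ) * Complex.I) + 1/2)⁻¹) + 2 * π * NN k (-1/2) := by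
  have hk1 : (1:ℝ) ≤ k := by exact_mod_cast hk
  have ne : ∀ z : ℂ, z.re ≠ 0 → z ≠ 0 := fun z hz h => hz (by rw [h]; simp)
  set N0 := NN k (-1/2) with hN0
  set f : ℂ → ℂ := fun s => dslope (NN k) (-1/2) s + N0 * (s + 5/2)⁻¹ with hf
  have hfs : ∀ s : ℂ, s + 1/2 ≠ 0 → f s = NN k s * (s + 1/2)⁻¹ - N0 * gg s := by
    intro s hs
    have : s ≠ -1/2 := fun h => hs (by rw [h]; ring)
    simp only [hf]
    rw [dslope_of_ne _ this, slope_def_field, gg, ← hN0,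
      show s - -1/2 = s + 1/2 by ring]
    ring
  have hU : IsOpen {s : ℂ | -3/2 < s.re ∧ s.re < 0} :=
    (isOpen_lt continuous_const Complex.continuous_re).inter
      (isOpen_lt Complex.continuous_re continuous_const)
  have hdN : DifferentiableOn ℂ (NN k) {s : ℂ | -3/2 < s.re ∧ s.re < 0} := fun s hs =>
    (dNN k hs.1 hs.2 (by linarith [hs.1])).differentiableWithinAt
  have hmem : {s : ℂ | -3/2 < s.re ∧ s.re < 0} ∈ nhds (-1/2 : ℂ) :=
    hU.mem_nhds (by constructor <;> norm_num)
  have hds := (Complex.differentiableOn_dslope hmem).2 hdN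
  have hd : DifferentiableOn ℂ f {s | -1 ≤ s.re ∧ s.re ≤ c} := by
    refine DifferentiableOn.add (hds.mono fun s hs => ⟨by linarith [hs.1], by linarith [hs.2]⟩) ?_
    refine DifferentiableOn.const_mul (DifferentiableOn.inv (by fun_prop) fun s hs => ?_) _
    exact ne _ (by simp; linarith [hs.1])
  have hB := SB_NN k (a := -1) (b := c) (by norm_num) hc2 (by linarith)
  have iN : Integrable fun y : ℝ => NN k (((-1 : ℝ) : ℂ) + (y : ℂ) * Complex.I) *
        ((((-1 : ℝ) : ℂ) + (y : ℂ) * Complex.I) + 1/2)⁻¹ := by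
    have i : SB (fun s => (s + 1/2)⁻¹) (-1) (-1) (-1) := SB_inv (p := 1/2) (by norm_num)
      (fun s h1 h2 => by
        have : (s + 1/2).re = -(1/2) := by simp; linarith
        rw [this, abs_neg, abs_of_pos (by norm_num)]) (fun s => by simp)
    have hb2 := (SB_NN k (a := -1) (b := -1) (by norm_num) (by norm_num) (by linarith)).mul i
    refine integrable_of_SB (f := fun s => NN k s * (s + 1/2)⁻¹) (a := -1) (b := -1) le_rfl le_rfl
      (line_cont (f := fun s => NN k s * (s + 1/2)⁻¹) (a := -1) (b := -1) le_rfl le_rfl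
        fun s hs => ?_) (hb2.mono (by norm_num))
    refine ContinuousAt.continuousWithinAt (ContinuousAt.mul ?_ (ContinuousAt.inv₀ (by fun_prop) ?_))
    · exact (dNN k (by linarith [hs.1]) (by linarith [hs.2]) (by linarith [hs.1])).continuousAt
    · exact ne _ (by simp; linarith [hs.2])
  have el : ∀ y : ℝ, f (((-1 : ℝ) : ℂ) + (y : ℂ) * Complex.I) =
      NN k (((-1 : ℝ) : ℂ) + (y : ℂ) * Complex.I) *
        ((((-1 : ℝ) : ℂ) + (y : ℂ) * Complex.I) + 1/2)⁻¹ -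
        N0 * gg (((-1 : ℝ) : ℂ) + (y : ℂ) * Complex.I) := fun y =>
    hfs _ (ne _ (by simp; norm_num))
  have er : ∀ y : ℝ, f ((c : ℂ) + (y : ℂ) * Complex.I) =
      FF k ((c : ℂ) + (y : ℂ) * Complex.I) - N0 * gg ((c : ℂ) + (y : ℂ) * Complex.I) := by
    intro y
    have h1 : ((c : ℂ) + (y : ℂ) * Complex.I) + 1/2 ≠ 0 := ne _ (by simp; linarith)
    rw [hfs _ h1, FF_eq_NN k h1 (ne _ (by simp; linarith))]
  have g1 := (gg_line (-1) (by norm_num) (by norm_num)).const_mul N0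
  have g2 := (gg_line c (by linarith) (by linarith)).const_mul N0
  obtain ⟨M, hM, hB⟩ := hB
  have hsh := shift (f := f) (a := -1) (b := c) (M := M + 2 * ‖N0‖) (by linarith) hd ?_ ?_ ?_
  · simp only [el, er] at hsh
    rw [integral_sub iN g1, integral_sub (FF_int k hc1 hc2) g2, integral_const_mul,
      integral_const_mul, gg_left, gg_right c (by linarith)] at hsh
    linear_combination -hsh
  · intro s h1 h2 h3
    have hne : s + 1/2 ≠ 0 := by
      intro h
      have := congrArg Complex.im h
      simp at this
      rw [this] at h3
      norm_num at h3
    have hpos : 0 < |s.im| := by linarith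
    have inv_le : ∀ q : ℝ, ‖(s + q)⁻¹‖ ≤ |s.im|⁻¹ := by
      intro q
      rw [norm_inv]
      apply inv_anti₀ hpos
      simpa using Complex.abs_im_le_norm (s + q)
    have b1 := inv_le (1/2)
    have b2 := inv_le (5/2)
    push_cast at b1 b2
    have b3 : ‖NN k s‖ ≤ M := by
      refine (hB s h1 h2).trans ?_
      have : (1 + |s.im|) ^ (-2:ℤ) ≤ 1 := by
        rw [zpow_neg]
        apply inv_le_one_of_one_le₀
        have : (1 + |s.im|) ^ (2:ℤ) = (1 + |s.im|) ^ 2 := by norm_cast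
        rw [this]
        nlinarith
      nlinarith
    rw [hfs s hne, gg]
    calc _ ≤ ‖NN k s‖ * ‖(s + 1/2)⁻¹‖ + ‖N0‖ * (‖(s + 1/2)⁻¹‖ + ‖(s + 5/2)⁻¹‖) := by
          refine (norm_sub_le _ _).trans ?_
          rw [norm_mul, norm_mul]
          gcongr
          exact norm_sub_le _ _
      _ ≤ M * |s.im|⁻¹ + ‖N0‖ * (|s.im|⁻¹ + |s.im|⁻¹) := by gcongr
      _ = _ := by rw [div_eq_mul_inv]; ring
  · simp only [el]; exact iN.sub g1
  · simp only [er]; exact (FF_int k hc1 hc2).sub g2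

noncomputable def eps (k : ℕ) : ℝ :=
  4 ^ k * (2 * k + 1) * (Real.Gamma (k - 1/2) / Real.Gamma (2 * k)) * Real.Gamma (k - 1/2)

lemma remainder : ∃ C : ℝ, ∀ k : ℕ, 1 ≤ k →
    ‖∫ y : ℝ, NN k (((-1 : ℝ) : ℂ) + (y : ℂ) * Complex.I) *
        ((((-1 : ℝ) : ℂ) + (y : ℂ) * Complex.I) + 1/2)⁻¹‖ ≤ C * eps k := by
  have i : SB (fun s => (s + 1/2)⁻¹) (-1) (-1) (-1) := SB_inv (p := 1/2) (by norm_num)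
      (fun s h1 h2 => by
        have : (s + 1/2).re = -(1/2) := by simp; linarith
        rw [this, abs_neg, abs_of_pos (by norm_num)]) (fun s => by simp)
  have r1 : SB (fun s => Complex.Gamma (s + 3/2) / Complex.Gamma (s + 2)) (-1) (-1) 0 :=
    (SB_ratio (g := fun s => s + 3/2) (p := 1/2) (q := 1/2) (by norm_num) (1/2)
      (by norm_num) (fun s h1 h2 => by simp; constructor <;> linarith)).congr
      (fun s _ _ => by push_cast; ring_nf)
  have r4 : SB (fun s => Complex.Gamma (-s)) (-1) (-1) (-4) :=
    SB_Gamma4 (g := fun s => -s) (p := 1) (q := 1) (by norm_num)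
      (fun s h1 h2 => by simp; constructor <;> linarith) (fun s => by simp)
  obtain ⟨M, hM, hP⟩ := ((((r1.mul (SB_affine 1 1 (-1) (-1))).mul i).mul r4).mul (SB_E8 (-1) (-1)))
  refine ⟨3 * M * π, fun k hk => ?_⟩
  have hk1 : (1:ℝ) ≤ k := by exact_mod_cast hk
  have ge : 0 < Real.Gamma (k - 1/2) := Real.Gamma_pos_of_pos (by linarith)
  have ge2 : 0 < Real.Gamma (2 * k) := Real.Gamma_pos_of_pos (by linarith)
  have heps : 0 ≤ eps k := by unfold eps; positivity
  have hb : ∀ y : ℝ, ‖NN k (((-1 : ℝ) : ℂ) + (y : ℂ) * Complex.I) *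
        ((((-1 : ℝ) : ℂ) + (y : ℂ) * Complex.I) + 1/2)⁻¹‖ ≤ 3 * M * eps k * (1 + y ^ 2)⁻¹ := by
    intro y
    set s : ℂ := ((-1 : ℝ) : ℂ) + (y : ℂ) * Complex.I with hs
    have re : s.re = -1 := by simp [hs]
    have im : s.im = y := by simp [hs]
    have h1 := hP s (by rw [re]) (by rw [re])
    rw [im] at h1
    have zr : (s + k + 1/2).re = k - 1/2 := by simp [re]; ring
    have h2 := norm_ratio_le (z := s + k + 1/2) (β := k + 1/2) (by rw [zr]; linarith) (by linarith)
    have h3 := norm_Gamma_le (z := s + k + 1/2) (by rw [zr]; linarith)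
    rw [zr] at h2 h3
    rw [show s + k + 1/2 + ((k + 1/2 : ℝ) : ℂ) = s + 2 * k + 1 by push_cast; ring,
      show (k:ℝ) - 1/2 + (k + 1/2) = 2 * k by ring] at h2
    have h4 : ‖3 * s + (2 * k + 1)‖ ≤ 3 * (2 * k + 1) * (1 + |y|) := by
      have := Complex.norm_le_abs_re_add_abs_im (3 * s + (2 * k + 1))
      have e1 : (3 * s + (2 * k + 1)).re = 2 * k - 2 := by simp [re]; ring
      have e2 : (3 * s + (2 * k + 1)).im = 3 * y := by simp [im]
      rw [e1, e2, abs_mul, abs_of_nonneg (by linarith : (0:ℝ) ≤ 2 * k - 2), abs_of_pos (by norm_num : (0:ℝ) < 3)] at this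
      nlinarith [abs_nonneg y]
    have e : NN k s * (s + 1/2)⁻¹ = (Complex.Gamma (s + 3/2) / Complex.Gamma (s + 2) * (1 * s + 1) *
        (s + 1/2)⁻¹ * Complex.Gamma (-s) * E8 s) * (4 ^ k *
        (Complex.Gamma (s + k + 1/2) / Complex.Gamma (s + 2 * k + 1)) *
        Complex.Gamma (s + k + 1/2) * (3 * s + (2 * k + 1))) := by
      unfold NN; ring
    rw [e, norm_mul]
    have h5 : ‖4 ^ k * (Complex.Gamma (s + k + 1/2) / Complex.Gamma (s + 2 * k + 1)) *
        Complex.Gamma (s + k + 1/2) * (3 * s + (2 * k + 1))‖ ≤ 3 * eps k * (1 + |y|) := by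
      rw [norm_mul, norm_mul, norm_mul, norm_pow]
      have : ‖(4:ℂ)‖ = 4 := by norm_num
      rw [this]
      calc _ ≤ 4 ^ k * (Real.Gamma (k - 1/2) / Real.Gamma (2 * k)) * Real.Gamma (k - 1/2) *
            (3 * (2 * k + 1) * (1 + |y|)) := by gcongr
        _ = _ := by unfold eps; ring
    refine (mul_le_mul h1 h5 (norm_nonneg _) (by positivity)).trans ?_
    have hy : 0 < 1 + |y| := by positivity
    have hz : (1 + |y|) ^ ((0 + 1 + -1 + -4 + 0 : ℤ)) * (1 + |y|) ≤ (1 + y ^ 2)⁻¹ := by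
      have : (1 + |y|) ^ ((0 + 1 + -1 + -4 + 0 : ℤ)) * (1 + |y|) = (1 + |y|) ^ (-3 : ℤ) := by
        rw [← zpow_add_one₀ hy.ne']; norm_num
      rw [this, zpow_neg]
      apply inv_anti₀ (by positivity)
      have : (1 + |y|) ^ (3:ℤ) = (1 + |y|) ^ 3 := by norm_cast
      rw [this]
      have h0 := abs_nonneg y
      have := sq_abs y
      nlinarith [pow_nonneg h0 3]
    calc _ = 3 * M * eps k * ((1 + |y|) ^ ((0 + 1 + -1 + -4 + 0 : ℤ)) * (1 + |y|)) := by ring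
      _ ≤ _ := by gcongr
  refine (norm_integral_le_of_norm_le (integrable_inv_one_add_sq.const_mul _)
    (Filter.Eventually.of_forall hb)).trans (le_of_eq ?_)
  rw [integral_const_mul, integral_univ_inv_one_add_sq]
  ring
noncomputable def uu (n : ℕ) : ℝ := √n * Real.Gamma n / Real.Gamma (n + 1/2)

lemma prod_half2 (n : ℕ) : (∏ j ∈ Finset.range n, ((1/2 : ℝ) + j)) * Real.Gamma (1/2) =
    Real.Gamma (n + 1/2) := by
  induction n with
  | zero => simp
  | succ n ih =>
    rw [Finset.prod_range_succ, mul_right_comm, ih]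
    have : (n:ℝ) + 1/2 ≠ 0 := by positivity
    push_cast
    rw [show (n:ℝ) + 1 + 1/2 = (n + 1/2) + 1 by ring, Real.Gamma_add_one this]
    ring

lemma uu_lim : Filter.Tendsto uu Filter.atTop (nhds 1) := by
  have h := Real.GammaSeq_tendsto_Gamma (1/2)
  have hG : 0 < Real.Gamma (1/2) := Real.Gamma_pos_of_pos (by norm_num)
  have h1 : Filter.Tendsto (fun n : ℕ => 1 + (1/2) * ((n:ℝ))⁻¹) Filter.atTop (nhds (1 + 1/2 * 0)) :=
    (tendsto_inv_atTop_nhds_zero_nat.const_mul (1/2)).const_add 1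
  have h2 := (h.mul h1).div_const (Real.Gamma (1/2))
  have e : Real.Gamma (1/2) * (1 + 1/2 * 0) / Real.Gamma (1/2) = 1 := by
    field_simp; norm_num
  rw [e] at h2
  refine h2.congr' ?_
  filter_upwards [Filter.eventually_ge_atTop 1] with n hn
  have hn0 : (0:ℝ) < n := by exact_mod_cast hn
  have hp := prod_half2 (n + 1)
  push_cast at hp
  rw [show (n:ℝ) + 1 + 1/2 = (n + 1/2) + 1 by ring, Real.Gamma_add_one (by positivity)] at hp
  have hg : 0 < Real.Gamma (n + 1/2) := Real.Gamma_pos_of_pos (by positivity)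
  have hp' : ∏ j ∈ Finset.range (n + 1), ((1/2 : ℝ) + j) =
      (n + 1/2) * Real.Gamma (n + 1/2) / Real.Gamma (1/2) := by
    rw [← hp]; field_simp
  have hf : ((n.factorial : ℕ) : ℝ) = n * Real.Gamma n := by
    rw [← Real.Gamma_nat_eq_factorial, Real.Gamma_add_one hn0.ne']
  rw [Real.GammaSeq, hp', hf, uu, Real.sqrt_eq_rpow]
  field_simp

lemma dup (k : ℕ) (hk : 1 ≤ k) :
    4 ^ k * (Real.Gamma k * Real.Gamma (k + 1/2)) = Real.Gamma (2 * k) * (2 * √π) := by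
  have h := Real.Gamma_mul_Gamma_add_half k
  rw [h]
  have : (2:ℝ) ^ (1 - 2 * (k:ℝ)) = 2 / 4 ^ k := by
    rw [Real.rpow_sub (by norm_num), Real.rpow_one, Real.rpow_mul (by norm_num)]
    norm_num
  rw [this]
  field_simp

lemma eps_lim : Filter.Tendsto eps Filter.atTop (nhds 0) := by
  have hi : Filter.Tendsto (fun n : ℕ => ((n:ℝ))⁻¹) Filter.atTop (nhds 0) :=
    tendsto_inv_atTop_nhds_zero_nat
  have h1 := (hi.const_add 2)
  have h2 := ((hi.const_mul (1/2)).const_sub 1).inv₀ (by norm_num)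
  have h3 := (hi.sqrt)
  have h4 := uu_lim.inv₀ one_ne_zero
  have h := ((((h1.mul h2).mul h2).mul h3).mul h4).const_mul (2 * √π)
  simp only [Real.sqrt_zero, mul_zero, zero_mul] at h
  refine h.congr' ?_
  filter_upwards [Filter.eventually_ge_atTop 1] with n hn
  have hn0 : (1:ℝ) ≤ n := by exact_mod_cast hn
  have hd := dup n hn
  have g1 : 0 < Real.Gamma n := Real.Gamma_pos_of_pos (by linarith)
  have g2 : 0 < Real.Gamma (n - 1/2) := Real.Gamma_pos_of_pos (by linarith)
  have g3 : 0 < Real.Gamma (2 * n) := Real.Gamma_pos_of_pos (by linarith)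
  have g4 : (n:ℝ) - 1/2 ≠ 0 := by linarith
  have e1 : Real.Gamma (n + 1/2) = (n - 1/2) * Real.Gamma (n - 1/2) := by
    rw [← Real.Gamma_add_one g4]; ring_nf
  have hn1 : (0:ℝ) < n := by linarith
  have hsq : 0 < √(n:ℝ) := Real.sqrt_pos.2 hn1
  rw [e1] at hd
  have e2 : (4:ℝ) ^ n = Real.Gamma (2 * n) * (2 * √π) / (Real.Gamma n * ((n - 1/2) * Real.Gamma (n - 1/2))) := by
    rw [← hd, mul_div_cancel_right₀ _ (mul_ne_zero g1.ne' (mul_ne_zero g4 g2.ne'))]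
  have e3 : (1:ℝ) - 1/2 * (n:ℝ)⁻¹ = (n - 1/2) * (n:ℝ)⁻¹ := by field_simp
  have e4 : √(n:ℝ)⁻¹ = √n * (n:ℝ)⁻¹ := by
    rw [Real.sqrt_inv]
    have := Real.mul_self_sqrt hn1.le
    field_simp
    nlinarith
  have e5 : (2:ℝ) + (n:ℝ)⁻¹ = (2 * n + 1) * (n:ℝ)⁻¹ := by field_simp
  rw [eps, uu, e1, e2, e3, e4, e5]
  generalize Real.Gamma (n - 1/2) = G at *
  generalize Real.Gamma (2 * n) = G2 at *
  generalize Real.Gamma n = G1 at *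
  generalize (n:ℝ) - 1/2 = m at *
  field_simp

noncomputable def aa (k : ℕ) : ℝ :=
  4 ^ k * (Real.Gamma k / Real.Gamma (2 * k + 1/2)) * Real.Gamma k * (2 * k - 1/2)

lemma aa_lim : Filter.Tendsto aa Filter.atTop (nhds (2 * √2 * √π)) := by
  have hi : Filter.Tendsto (fun n : ℕ => ((n:ℝ))⁻¹) Filter.atTop (nhds 0) :=
    tendsto_inv_atTop_nhds_zero_nat
  have h1 := ((hi.const_mul (1/2)).const_sub 2)
  have h2 : Filter.Tendsto (fun n : ℕ => uu (2 * n)) Filter.atTop (nhds 1) :=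
    uu_lim.comp (Filter.tendsto_id.const_mul_atTop' (by norm_num))
  have h := ((h1.mul uu_lim).mul h2).const_mul (√2 * √π)
  have e0 : √2 * √π * ((2 - 1/2 * 0) * 1 * 1) = 2 * √2 * √π := by ring
  rw [e0] at h
  refine h.congr' ?_
  filter_upwards [Filter.eventually_ge_atTop 1] with n hn
  have hn0 : (1:ℝ) ≤ n := by exact_mod_cast hn
  have hd := dup n hn
  have g1 : 0 < Real.Gamma n := Real.Gamma_pos_of_pos (by linarith)
  have g2 : 0 < Real.Gamma (n + 1/2) := Real.Gamma_pos_of_pos (by linarith)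
  have g3 : 0 < Real.Gamma (2 * n) := Real.Gamma_pos_of_pos (by linarith)
  have g4 : 0 < Real.Gamma (2 * n + 1/2) := Real.Gamma_pos_of_pos (by linarith)
  have hn1 : (0:ℝ) < n := by linarith
  have hsq : 0 < √(n:ℝ) := Real.sqrt_pos.2 hn1
  have e2 : (4:ℝ) ^ n = Real.Gamma (2 * n) * (2 * √π) / (Real.Gamma n * Real.Gamma (n + 1/2)) := by
    rw [← hd]; field_simp
  have e3 : (2:ℝ) - 1/2 * (n:ℝ)⁻¹ = (2 * n - 1/2) * (n:ℝ)⁻¹ := by field_simp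
  have e4 : (n:ℝ)⁻¹ * √n * √n = 1 := by
    rw [mul_assoc, Real.mul_self_sqrt hn1.le]; field_simp
  have e5 : √(2:ℝ) * √2 = 2 := Real.mul_self_sqrt (by norm_num)
  rw [aa, uu, uu, e2, e3]
  push_cast
  rw [Real.sqrt_mul (by norm_num)]
  generalize Real.Gamma (n + 1/2) = G at *
  generalize Real.Gamma (2 * n + 1/2) = G3 at *
  generalize Real.Gamma (2 * n) = G2 at *
  generalize Real.Gamma n = G1 at *
  generalize (2 * (n:ℝ) - 1/2) = m at *
  calc _ = (√2 * √2) * ((n:ℝ)⁻¹ * √n * √n) * √π * m * G1 / G * G2 / G3 := by ring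
    _ = _ := by
      rw [e4, e5]
      field_simp

lemma E8_half : E8 (-1/2) = (((2 * √2)⁻¹ : ℝ) : ℂ) := by
  have h : Real.exp (-(3/2) * Real.log 2) = (2 * √2)⁻¹ := by
    have h2 : √(2:ℝ) = Real.exp (1/2 * Real.log 2) := by
      rw [Real.sqrt_eq_rpow, Real.rpow_def_of_pos (by norm_num), mul_comm]
    have h3 : (2:ℝ) = Real.exp (Real.log 2) := (Real.exp_log (by norm_num)).symm
    have h4 : 2 * √(2:ℝ) = Real.exp (Real.log 2) * Real.exp (1/2 * Real.log 2) := by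
      rw [← h2, ← h3]
    rw [h4, ← Real.exp_add, ← Real.exp_neg]
    congr 1
    ring
  rw [← h, E8]
  push_cast
  congr 1
  ring

lemma NN_half (k : ℕ) (hk : 1 ≤ k) : NN k (-1/2) = ((aa k * (2 * √2)⁻¹ : ℝ) : ℂ) := by
  have q : Complex.Gamma (1/2) ≠ 0 := Complex.Gamma_ne_zero_of_re_pos (by norm_num)
  have g : Complex.Gamma (-1/2 + 2) = 1/2 * Complex.Gamma (1/2) := by
    rw [← Complex.Gamma_add_one _ (by norm_num)]; norm_num
  unfold NN aa
  rw [E8_half, g, show (-1/2 + 3/2 : ℂ) = 1 by norm_num, Complex.Gamma_one,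
    show (-1/2 + k + 1/2 : ℂ) = ((k:ℝ) : ℂ) by push_cast; ring,
    show (-1/2 + 2 * k + 1 : ℂ) = ((2 * k + 1/2 : ℝ) : ℂ) by push_cast; ring,
    show (-(-1/2) : ℂ) = 1/2 by norm_num, Complex.Gamma_ofReal, Complex.Gamma_ofReal]
  push_cast
  generalize Complex.Gamma (1/2) = G at *
  have : G * G⁻¹ = 1 := mul_inv_cancel₀ q
  simp only [div_eq_mul_inv, mul_inv]
  generalize ((Real.Gamma (2 * k + 1 * 2⁻¹) : ℝ) : ℂ)⁻¹ = X
  linear_combination (4 ^ k * (Real.Gamma k : ℂ)^2 * X * (2 * k - 1/2) * ((2 : ℂ)⁻¹ * (√2 : ℂ)⁻¹)) * this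

lemma FF0_int {c : ℝ} (hc1 : -1/2 < c) (hc2 : c < 0) :
    ∫ y : ℝ, FF 0 ((c : ℂ) + (y : ℂ) * Complex.I) = ((2 * π * √π : ℝ) : ℂ) := by
  obtain ⟨C, hC⟩ := remainder
  have l1 : Filter.Tendsto (fun k => ∫ y : ℝ, NN k (((-1 : ℝ) : ℂ) + (y : ℂ) * Complex.I) *
        ((((-1 : ℝ) : ℂ) + (y : ℂ) * Complex.I) + 1/2)⁻¹) Filter.atTop (nhds 0) := by
    refine squeeze_zero_norm' (a := fun k => C * eps k) ?_ (by simpa using eps_lim.const_mul C)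
    filter_upwards [Filter.eventually_ge_atTop 1] with k hk using hC k hk
  have l2 : Filter.Tendsto (fun k => ((2 * π * (aa k * (2 * √2)⁻¹) : ℝ) : ℂ)) Filter.atTop
      (nhds ((2 * π * √π : ℝ) : ℂ)) := by
    refine (Complex.continuous_ofReal.tendsto _).comp ?_
    have := (aa_lim.mul_const (2 * √2)⁻¹).const_mul (2 * π)
    convert this using 2
    field_simp
  have l3 := l1.add l2
  rw [zero_add] at l3
  refine tendsto_nhds_unique (tendsto_const_nhds.congr' ?_) l3
  filter_upwards [Filter.eventually_ge_atTop 1] with k hk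
  rw [← FF_const k hc1 hc2, resid k hk hc1 hc2, NN_half k hk]
  push_cast
  ring

lemma h7_eq (s : ℂ) : h7 s = (((√π ^ 3)⁻¹ : ℝ) : ℂ) * FF 0 s := by
  have hg : Complex.Gamma (1/2) = ((√π : ℝ) : ℂ) := by
    rw [← Real.Gamma_one_half_eq, ← Complex.Gamma_ofReal]; norm_num
  have he : cpowR 2 (3 * s) = E8 s := rfl
  unfold h7 cpoch FF
  rw [he, hg, Complex.Gamma_one]
  simp only [Nat.cast_zero, mul_zero, add_zero, pow_zero, zero_add, div_one]
  rw [add_comm s 1, add_comm s (1/2)]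
  push_cast
  simp only [div_eq_mul_inv, mul_inv, mul_pow, inv_pow]
  ring

end BarnesPf

theorem barnes_integral_1_over_pi (c : ℝ) (hc1 : -1/2 < c) (hc2 : c < 0) :
    Integrable (fun y : ℝ => h7 ((c : ℂ) + (y : ℂ) * Complex.I)) ∧
    (1 / (2*(π : ℂ))) * ∫ y : ℝ, h7 ((c : ℂ) + (y : ℂ) * Complex.I) =
      ((1 / π : ℝ) : ℂ) := by
  simp only [BarnesPf.h7_eq]
  refine ⟨(BarnesPf.FF_int 0 hc1 hc2).const_mul _, ?_⟩
  rw [integral_const_mul, BarnesPf.FF0_int hc1 hc2]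
  have h : (√π) ^ 2 = π := Real.sq_sqrt Real.pi_pos.le
  have hp := Real.pi_pos
  have hs : 0 < √π := Real.sqrt_pos.2 hp
  have : 1 / (2 * π) * ((√π ^ 3)⁻¹ * (2 * π * √π)) = 1 / π := by
    rw [show √π ^ 3 = π * √π by rw [pow_succ, h]]
    field_simp
  rw [← this]
  push_cast
  ring
end
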